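/- arXiv:1105.2415 — 3 statements merged into one kernel-verified Lean document; each statement's English description precedes it below -/
import Mathlib

section
/- Suppose P is Q-normal, i.e., μ(P) = τ(P). Then its image Q := π_P(P) under the natural projection is Q-normal, core(Q) is the single point π_P(core(P)), and μ(Q) = μ(P). Moreover, if P is α-canonical, then Q is α-canonical. -/
open scoped BigOperators Pointwise

noncomputable section

/-- Pairing `⟨a, x⟩ = ∑ aⱼ xⱼ` of an integer linear functional with a real point. -/
def ipair {n : ℕ} (a : Fin n → ℤ) (x : Fin n → ℝ) : ℝ := ∑ j, (a j : ℝ) * x j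

/-- An integer vector is primitive if it is nonzero and not a nontrivial integer
multiple of another integer vector. -/
def IsPrimitive {n : ℕ} (a : Fin n → ℤ) : Prop :=
  a ≠ 0 ∧ ∀ (k : ℤ) (b : Fin n → ℤ), a = k • b → IsUnit k

/-- The set of integer (lattice) points of `ℝⁿ`. -/
def IntPts (n : ℕ) : Set (Fin n → ℝ) := Set.range (fun z : Fin n → ℤ => fun j => (z j : ℝ))

/-- The dimension of a subset of `ℝⁿ` (the dimension of its affine hull). -/
def setDim {n : ℕ} (S : Set (Fin n → ℝ)) : ℕ := Module.finrank ℝ (vectorSpan ℝ S)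

/-- An irredundant facet description `P = {x : A x ≥ b}` of an `n`-dimensional
rational polytope: the rows `aᵢ` of `A` are primitive integer vectors, the right hand
sides are rational, `P` is bounded and `n`-dimensional, every inequality defines a facet
(a face of dimension `n-1`), and no inequality is repeated. -/
structure PolyDesc (n m : ℕ) : Type where
  hm : 0 < m
  A : Fin m → Fin n → ℤ
  b : Fin m → ℚ
  prim : ∀ i, IsPrimitive (A i)
  bounded : Bornology.IsBounded {x : Fin n → ℝ | ∀ i, (b i : ℝ) ≤ ipair (A i) x}
  fulldim : setDim {x : Fin n → ℝ | ∀ i, (b i : ℝ) ≤ ipair (A i) x} = n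
  facet_dim : ∀ i, setDim {x : Fin n → ℝ |
      (∀ j, (b j : ℝ) ≤ ipair (A j) x) ∧ ipair (A i) x = (b i : ℝ)} + 1 = n
  irredundant : Function.Injective (fun i => (A i, b i))

namespace PolyDesc

variable {n m : ℕ} (D : PolyDesc n m)

/-- The polytope `P` itself. -/
def pts : Set (Fin n → ℝ) := {x | ∀ i, (D.b i : ℝ) ≤ ipair (D.A i) x}

/-- Lattice distance `d_{Fᵢ}(x) = ⟨aᵢ, x⟩ - bᵢ` from (the hyperplane spanned by)
the `i`-th facet. -/
def dF (i : Fin m) (x : Fin n → ℝ) : ℝ := ipair (D.A i) x - (D.b i : ℝ)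

/-- Lattice distance `d_P(x) = minᵢ d_{Fᵢ}(x)` from the boundary of `P`. -/
def dist (x : Fin n → ℝ) : ℝ :=
  Finset.univ.inf'
    (Finset.univ_nonempty_iff.mpr (Fin.pos_iff_nonempty.mp D.hm))
    (fun i => D.dF i x)

/-- The adjoint polytope `P⁽ˢ⁾ = {x : d_P(x) ≥ s}`. -/
def adj (s : ℝ) : Set (Fin n → ℝ) := {x | s ≤ D.dist x}

/-- The `i`-th facet `Fᵢ` of `P`. -/
def facet (i : Fin m) : Set (Fin n → ℝ) := {x ∈ D.pts | ipair (D.A i) x = (D.b i : ℝ)}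

/-- The set `{s > 0 : P⁽ˢ⁾ ≠ ∅}`, whose supremum is `μ(P)⁻¹`. -/
def qcdInvSet : Set ℝ := {s : ℝ | 0 < s ∧ (D.adj s).Nonempty}

/-- `μ(P)⁻¹ = sup {s > 0 : P⁽ˢ⁾ ≠ ∅}`. -/
def qcdInv : ℝ := sSup D.qcdInvSet

/-- The ℚ-codegree `μ(P) = (sup {s > 0 : P⁽ˢ⁾ ≠ ∅})⁻¹`. -/
def qcd : ℝ := D.qcdInv⁻¹

/-- The core `core(P) = P^{(1/μ(P))}`. -/
def core : Set (Fin n → ℝ) := D.adj D.qcdInv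

/-- The codegree `cd(P) = min {k ∈ ℕ, k ≥ 1 : int(kP) ∩ ℤⁿ ≠ ∅}`. -/
def codeg : ℕ := sInf {k : ℕ | 0 < k ∧
  ∃ z : Fin n → ℤ, (fun j => (z j : ℝ)) ∈ interior ((k : ℝ) • D.pts)}

end PolyDesc

/-- The face of `S` on which the linear functional `u` is maximized. -/
def argFace {n : ℕ} (S : Set (Fin n → ℝ)) (u : Fin n → ℝ) : Set (Fin n → ℝ) :=
  {x ∈ S | ∀ y ∈ S, ∑ j, u j * y j ≤ ∑ j, u j * x j}

/-- `S` and `T` have the same normal fan: two linear functionals lie in the same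
(relatively open) cone of the normal fan of `S`, i.e. are maximized on the same face
of `S`, iff the same holds for `T`. -/
def SameNormalFan {n : ℕ} (S T : Set (Fin n → ℝ)) : Prop :=
  ∀ u v : Fin n → ℝ, (argFace S u = argFace S v ↔ argFace T u = argFace T v)

/-- The normal fan of `S` refines the normal fan of `T`. -/
def RefinesNormalFan {n : ℕ} (S T : Set (Fin n → ℝ)) : Prop :=
  ∀ u v : Fin n → ℝ, argFace S u = argFace S v → argFace T u = argFace T v

namespace PolyDesc
variable {n m : ℕ} (D : PolyDesc n m)

/-- `{s > 0 : N(P⁽ˢ⁾) = N(P)}`, whose supremum is `τ(P)⁻¹`. -/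
def nefInvSet : Set ℝ := {s : ℝ | 0 < s ∧ SameNormalFan (D.adj s) D.pts}

/-- `τ(P)⁻¹ = sup {s > 0 : N(P⁽ˢ⁾) = N(P)}`. -/
def nefInv : ℝ := sSup D.nefInvSet

/-- The nef value `τ(P)`. -/
def nefVal : ℝ := D.nefInv⁻¹

/-- The set of inequalities active at `x`; the normal cone of the minimal face of `P`
containing `x` is generated by `{aᵢ : i ∈ active x}`, and all cones of the normal fan
of `P` arise in this way. -/
def active (x : Fin n → ℝ) : Set (Fin m) := {i | ipair (D.A i) x = (D.b i : ℝ)}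

/-- The normal cone at the vertex `v` is ℚ-Gorenstein of index `r`, witnessed by the
primitive lattice point `u = u_σ` with `⟨aᵢ, u⟩ = r` for all active `i`. -/
def VertexQG (v : Fin n → ℝ) (u : Fin n → ℤ) (r : ℤ) : Prop :=
  IsPrimitive u ∧ 0 < r ∧ ∀ i ∈ D.active v, (∑ j, D.A i j * u j) = r

/-- The normal fan of `P` is ℚ-Gorenstein: every maximal cone (normal cone of a
vertex, i.e. of an extreme point) is ℚ-Gorenstein. -/
def QGorenstein : Prop := ∀ v ∈ Set.extremePoints ℝ D.pts, ∃ u r, D.VertexQG v u r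

end PolyDesc

/-- The point `v(s) = v + (s/r_σ) • u_σ`. -/
def vmove {n : ℕ} (v : Fin n → ℝ) (s : ℝ) (u : Fin n → ℤ) (r : ℤ) : Fin n → ℝ :=
  v + (s / (r : ℝ)) • (fun j => ((u j : ℝ)))

/-- The height of a point `y` in the cone generated by `{aᵢ : i ∈ I}`:
`ht(y) = max {∑ λᵢ : λᵢ ≥ 0, ∑ λᵢ aᵢ = y}`. -/
def coneHeight {n m : ℕ} (D : PolyDesc n m) (I : Set (Fin m)) (y : Fin n → ℝ) : ℝ :=
  sSup {t : ℝ | ∃ c : Fin m → ℝ, (∀ i, 0 ≤ c i) ∧ (∀ i ∉ I, c i = 0) ∧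
    (y = ∑ i, c i • (fun j => ((D.A i j : ℝ)))) ∧ t = ∑ i, c i}

/-- `P` is α-canonical: for every cone `σ` of the normal fan of `P` (the normal cone
of the minimal face containing a point `x ∈ P`, generated by `{aᵢ : i ∈ active x}`),
every nonzero lattice point of `σ` has height at least `α`. -/
def AlphaCanonical {n m : ℕ} (D : PolyDesc n m) (α : ℝ) : Prop :=
  ∀ x ∈ D.pts, ∀ z : Fin n → ℤ, z ≠ 0 →
    (∃ c : Fin m → ℝ, (∀ i, 0 ≤ c i) ∧ (∀ i ∉ D.active x, c i = 0) ∧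
      ((fun j => ((z j : ℝ))) = ∑ i, c i • (fun j => ((D.A i j : ℝ))))) →
    α ≤ coneHeight D (D.active x) (fun j => ((z j : ℝ)))

/-- `P` is a lattice polytope: the convex hull of finitely many integer points. -/
def IsLatticePoly {n : ℕ} (P : Set (Fin n → ℝ)) : Prop :=
  ∃ V : Finset (Fin n → ℤ),
    P = convexHull ℝ ((fun z : Fin n → ℤ => fun j => ((z j : ℝ))) '' (V : Set (Fin n → ℤ)))

/-- The `i`-th standard basis vector of `ℝᵗ`. -/
def stdBasisVec (t : ℕ) (i : Fin t) : Fin t → ℝ := fun j => if j = i then 1 else 0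

/-- The marking vectors of a Cayley sum: `0, e₁, …, e_t ∈ ℝᵗ`. -/
def cayleyVec (t : ℕ) : Fin (t + 1) → (Fin t → ℝ) :=
  fun j => if h : (j : ℕ) = 0 then 0 else stdBasisVec t ⟨(j : ℕ) - 1, by have := j.isLt; omega⟩

/-- The Cayley sum `Q₀ * ⋯ * Q_t = conv((Q₀ × {0}) ∪ (Q₁ × {e₁}) ∪ ⋯ ∪ (Q_t × {e_t}))`. -/
def cayleySum {k t : ℕ} (Q : Fin (t + 1) → Set (Fin k → ℝ)) :
    Set ((Fin k → ℝ) × (Fin t → ℝ)) :=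
  convexHull ℝ (⋃ j, (Q j) ×ˢ ({cayleyVec t j} : Set (Fin t → ℝ)))

/-- `P ⊆ ℝⁿ` is a Cayley polytope `P₀ * ⋯ * P_t` of length `t+1` of lattice polytopes
`Pⱼ ⊆ ℝᵏ` with `k + t = n`: some affine lattice isomorphism `ℤⁿ ≅ ℤᵏ × ℤᵗ`
identifies `P` with such a Cayley sum. -/
def IsCayley {n : ℕ} (P : Set (Fin n → ℝ)) (k t : ℕ) : Prop :=
  k + t = n ∧
  ∃ Q : Fin (t + 1) → Finset (Fin k → ℤ), (∀ j, (Q j).Nonempty) ∧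
  ∃ f : (Fin n → ℝ) ≃ᵃ[ℝ] (Fin k → ℝ) × (Fin t → ℝ),
    f '' IntPts n = (IntPts k) ×ˢ (IntPts t) ∧
    f '' P = cayleySum (fun j =>
      convexHull ℝ ((fun z : Fin k → ℤ => fun i => ((z i : ℝ))) '' (Q j : Set (Fin k → ℤ))))

/-- The unimodular simplex `Δₙ = conv(0, e₁, …, eₙ)`. -/
def unimodSimplex (n : ℕ) : Set (Fin n → ℝ) :=
  convexHull ℝ (insert (0 : Fin n → ℝ) (Set.range (stdBasisVec n)))

/-- Two subsets of `ℝⁿ` are unimodularly equivalent: an affine lattice automorphism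
maps one onto the other. -/
def UnimodEquiv {n : ℕ} (P P' : Set (Fin n → ℝ)) : Prop :=
  ∃ f : (Fin n → ℝ) ≃ᵃ[ℝ] (Fin n → ℝ), f '' IntPts n = IntPts n ∧ f '' P = P'

/-- The codegree `cd(P) = min {k ∈ ℕ, k ≥ 1 : int(kP) ∩ ℤⁿ ≠ ∅}` of a polytope given
as a set. -/
def codegS {n : ℕ} (P : Set (Fin n → ℝ)) : ℕ :=
  sInf {k : ℕ | 0 < k ∧ ∃ z : Fin n → ℤ, (fun j => (z j : ℝ)) ∈ interior ((k : ℝ) • P)}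

/-- `P` has lattice width one: some nonzero integer linear functional has minimum `c`
and maximum `c + 1` on `P`. -/
def HasLatticeWidthOne {n : ℕ} (P : Set (Fin n → ℝ)) : Prop :=
  ∃ u : Fin n → ℤ, u ≠ 0 ∧ ∃ c : ℤ,
    (∀ x ∈ P, (c : ℝ) ≤ ipair u x ∧ ipair u x ≤ (c : ℝ) + 1) ∧
    (∃ x ∈ P, ipair u x = (c : ℝ)) ∧ (∃ x ∈ P, ipair u x = (c : ℝ) + 1)

/-- `P` is a lattice pyramid: for some primitive `u`, `P` is the convex hull of a base
lying in the lattice hyperplane `{⟨u, ·⟩ = c}` and an apex at lattice distance one from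
it (this is equivalent to being unimodularly equivalent to
`conv((Q × {0}) ∪ {(0, …, 0, 1)})` for an `(n-1)`-dimensional lattice polytope `Q`). -/
def IsLatticePyramid {n : ℕ} (P : Set (Fin n → ℝ)) : Prop :=
  ∃ u : Fin n → ℤ, IsPrimitive u ∧ ∃ c : ℤ, ∃ apex ∈ P,
    ipair u apex = (c : ℝ) + 1 ∧
    P = convexHull ℝ ({x ∈ P | ipair u x = (c : ℝ)} ∪ {apex})

/-- `F` is a facet of `S`: an exposed face of dimension `dim S - 1`. -/
def IsFacetOf {n : ℕ} (F S : Set (Fin n → ℝ)) : Prop :=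
  IsExposed ℝ S F ∧ F.Nonempty ∧ setDim F + 1 = setDim S

/-- `P` is ℚ-normal: `μ(P) = τ(P)`. -/
def QNormal {n m : ℕ} (D : PolyDesc n m) : Prop := D.qcd = D.nefVal

/-- **Farkas' lemma** for finitely many linear functionals on a real vector space. -/
theorem farkas {V ι : Type*} [AddCommGroup V] [Module ℝ V] (s : Finset ι) :
    ∀ (f : ι → Module.Dual ℝ V) (u : Module.Dual ℝ V),
      (∀ v, (∀ i ∈ s, 0 ≤ f i v) → 0 ≤ u v) →
      ∃ c : ι → ℝ, (∀ i, 0 ≤ c i) ∧ (∀ i ∉ s, c i = 0) ∧ ∀ v, u v = ∑ i ∈ s, c i * f i v := by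
  classical
  induction s using Finset.induction_on with
  | empty =>
    intro f u h
    refine ⟨0, by simp, by simp, fun v => ?_⟩
    have h1 := h v (by simp)
    have h2 := h (-v) (by simp)
    simp only [map_neg] at h2
    simp
    linarith
  | insert k s hk ih =>
    intro f u h
    by_cases hs : ∀ v, (∀ i ∈ s, 0 ≤ f i v) → 0 ≤ u v
    · obtain ⟨c, h0, h1, h2⟩ := ih f u hs
      refine ⟨c, h0, fun i hi => h1 i fun h => hi (Finset.mem_insert_of_mem h), fun v => ?_⟩
      rw [Finset.sum_insert hk, h1 k hk, h2 v]
      simp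
    · push Not at hs
      obtain ⟨w, hw, huw⟩ := hs
      have hkw : f k w < 0 := by
        by_contra! hc
        exact absurd (h w fun i hi => by
          rcases Finset.mem_insert.mp hi with rfl | hi
          · exact hc
          · exact hw i hi) (not_le.mpr huw)
      -- project along `w` onto the kernel of `f k`
      set t : ℝ := (-f k w)⁻¹ with ht
      have htpos : 0 < t := inv_pos.mpr (by linarith)
      have htk : t * f k w = -1 := by
        rw [ht]
        have : f k w ≠ 0 := hkw.ne
        field_simp
      obtain ⟨c, h0, h1, h2⟩ := ih (fun i => f i + (t * f i w) • f k) (u + (t * u w) • f k) (by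
        intro v hv
        have := h (v + (t * f k v) • w) (by
          intro i hi
          rcases Finset.mem_insert.mp hi with rfl | hi
          · simp only [map_add, map_smul, smul_eq_mul]
            apply le_of_eq
            linear_combination (-f i v) * htk
          · have := hv i hi
            simp only [LinearMap.add_apply, LinearMap.smul_apply, smul_eq_mul] at this
            simp only [map_add, map_smul, smul_eq_mul]
            linarith)
        simp only [map_add, map_smul, smul_eq_mul] at this
        simp only [LinearMap.add_apply, LinearMap.smul_apply, smul_eq_mul]
        linarith)
      have hcs : ∀ i ∈ s, Function.update c k (∑ i ∈ s, c i * (t * f i w) - t * u w) i = c i := by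
        intro i hi
        rw [Function.update_of_ne]
        rintro rfl
        exact hk hi
      refine ⟨Function.update c k (∑ i ∈ s, c i * (t * f i w) - t * u w), ?_, ?_, ?_⟩
      · intro i
        by_cases hi : i = k
        · subst hi
          rw [Function.update_self]
          have : 0 ≤ ∑ i ∈ s, c i * (t * f i w) :=
            Finset.sum_nonneg fun i hi => mul_nonneg (h0 i) (mul_nonneg htpos.le (hw i hi))
          nlinarith
        · rw [Function.update_of_ne hi]
          exact h0 i
      · intro i hi
        rw [Finset.mem_insert, not_or] at hi
        rw [Function.update_of_ne hi.1]
        exact h1 i hi.2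
      · intro v
        have := h2 v
        simp only [LinearMap.add_apply, LinearMap.smul_apply, smul_eq_mul, mul_add,
          Finset.sum_add_distrib] at this
        have hsum := Finset.sum_congr rfl fun i hi => congrArg (· * f i v) (hcs i hi)
        rw [Finset.sum_insert hk, Function.update_self, hsum, sub_mul, Finset.sum_mul]
        simp only [mul_assoc] at this ⊢
        linarith

/-- The pairing with a fixed integer vector as a linear functional. -/
def ipairL {n : ℕ} (a : Fin n → ℤ) : Module.Dual ℝ (Fin n → ℝ) where
  toFun := ipair a
  map_add' x y := by simp [ipair, mul_add, Finset.sum_add_distrib]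
  map_smul' r x := by
    simp only [ipair, Pi.smul_apply, smul_eq_mul, Finset.mul_sum, RingHom.id_apply]
    exact Finset.sum_congr rfl fun j _ => by ring

@[simp] theorem ipairL_apply {n : ℕ} (a : Fin n → ℤ) (x : Fin n → ℝ) :
    ipairL a x = ipair a x := rfl

theorem ipair_add {n : ℕ} (a : Fin n → ℤ) (x y : Fin n → ℝ) :
    ipair a (x + y) = ipair a x + ipair a y := (ipairL a).map_add x y

theorem ipair_sub {n : ℕ} (a : Fin n → ℤ) (x y : Fin n → ℝ) :
    ipair a (x - y) = ipair a x - ipair a y := (ipairL a).map_sub x y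

theorem ipair_smul {n : ℕ} (a : Fin n → ℤ) (r : ℝ) (x : Fin n → ℝ) :
    ipair a (r • x) = r * ipair a x := (ipairL a).map_smul r x

theorem ipair_sum {n : ℕ} {ι : Type*} (a : Fin n → ℤ) (s : Finset ι) (x : ι → Fin n → ℝ) :
    ipair a (∑ i ∈ s, x i) = ∑ i ∈ s, ipair a (x i) := map_sum (ipairL a) x s

theorem add_ipair {n : ℕ} (a b : Fin n → ℤ) (x : Fin n → ℝ) :
    ipair (a + b) x = ipair a x + ipair b x := by
  simp [ipair, add_mul, Finset.sum_add_distrib]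

theorem nsmul_ipair {n : ℕ} (N : ℕ) (a : Fin n → ℤ) (x : Fin n → ℝ) :
    ipair (N • a) x = N * ipair a x := by
  simp [ipair, Finset.mul_sum, mul_assoc]

theorem zsmul_ipair {n : ℕ} (k : ℤ) (a : Fin n → ℤ) (x : Fin n → ℝ) :
    ipair (k • a) x = k * ipair a x := by
  simp [ipair, Finset.mul_sum, mul_assoc]

theorem sum_ipair {n : ℕ} {ι : Type*} (s : Finset ι) (a : ι → Fin n → ℤ) (x : Fin n → ℝ) :
    ipair (∑ i ∈ s, a i) x = ∑ i ∈ s, ipair (a i) x := by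
  simp only [ipair, Finset.sum_apply, Int.cast_sum, Finset.sum_mul]
  exact Finset.sum_comm

theorem ipair_single {n : ℕ} (a : Fin n → ℤ) (j : Fin n) :
    ipair a (Pi.single j 1) = a j := by
  simp [ipair, Pi.single_apply]

theorem ipair_injective {n : ℕ} {a b : Fin n → ℤ} (h : ∀ x, ipair a x = ipair b x) : a = b := by
  funext j
  have := h (Pi.single j 1)
  rw [ipair_single, ipair_single] at this
  exact_mod_cast this

theorem continuous_ipair {n : ℕ} (a : Fin n → ℤ) : Continuous (ipair a) := by
  unfold ipair
  fun_prop

theorem exists_ipair_ne_zero {n : ℕ} {a : Fin n → ℤ} (ha : a ≠ 0) : ∃ v, ipair a v ≠ 0 := by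
  by_contra! h
  exact ha (ipair_injective fun x => by rw [h x]; simp [ipair])

theorem exists_ipair_eq_one {n : ℕ} {a : Fin n → ℤ} (ha : a ≠ 0) : ∃ v, ipair a v = 1 := by
  obtain ⟨v, hv⟩ := exists_ipair_ne_zero ha
  exact ⟨(ipair a v)⁻¹ • v, by rw [ipair_smul, inv_mul_cancel₀ hv]⟩

theorem finrank_ker_ipairL {n : ℕ} {a : Fin n → ℤ} (ha : a ≠ 0) :
    Module.finrank ℝ (LinearMap.ker (ipairL a)) + 1 = n := by
  have h := Module.Dual.finrank_ker_add_one_of_ne_zero (f := ipairL a) (by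
    intro h
    obtain ⟨v, hv⟩ := exists_ipair_ne_zero ha
    exact hv (by rw [← ipairL_apply, h]; rfl))
  simpa using h

/-- Two primitive integer vectors spanning the same ray coincide. -/
theorem IsPrimitive.eq_of_pos_smul {n : ℕ} {a a' : Fin n → ℤ} (ha : IsPrimitive a)
    (ha' : IsPrimitive a') {t : ℝ} (ht : 0 < t) (h : ∀ j, (a' j : ℝ) = t * a j) : a' = a := by
  obtain ⟨j, hj⟩ : ∃ j, a j ≠ 0 := by
    by_contra! hc
    exact ha.1 (funext hc)
  have hjR : (a j : ℝ) ≠ 0 := by exact_mod_cast hj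
  set q : ℚ := (a' j : ℚ) / a j with hq
  have htq : t = (q : ℝ) := by
    rw [hq]
    push_cast
    rw [h j]
    field_simp
  have hq0 : 0 < q := by rw [htq] at ht; exact_mod_cast ht
  have key : ∀ l, (q.den : ℤ) * a' l = q.num * a l := by
    intro l
    have h1 := h l
    have h2 : (a' l : ℚ) = q * a l := by
      rw [htq] at h1
      exact_mod_cast h1
    have h3 : (q.den : ℚ) * a' l = q.num * a l := by
      rw [h2, ← mul_assoc, Rat.den_mul_eq_num]
    exact_mod_cast h3
  have hcop : IsCoprime q.num (q.den : ℤ) := Rat.isCoprime_num_den q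
  have hd : ∀ l, (q.den : ℤ) ∣ a l := fun l =>
    hcop.symm.dvd_of_dvd_mul_left ⟨a' l, (key l).symm⟩
  have hn : ∀ l, q.num ∣ a' l := fun l => hcop.dvd_of_dvd_mul_left ⟨a l, key l⟩
  choose e he using hd
  choose g hg using hn
  have hu1 := ha.2 q.den e (funext fun l => by simp [he l])
  have hu2 := ha'.2 q.num g (funext fun l => by simp [hg l])
  have hnum : 0 < q.num := Rat.num_pos.mpr hq0
  have hden : 0 < (q.den : ℤ) := by exact_mod_cast q.den_pos
  have e1 : (q.den : ℤ) = 1 := by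
    rcases Int.isUnit_iff.mp hu1 with h | h <;> omega
  have e2 : q.num = 1 := by
    rcases Int.isUnit_iff.mp hu2 with h | h <;> omega
  funext l
  have := key l
  rw [e1, e2] at this
  simpa using this

/-- If the kernel of `a` is contained in that of `a'`, then `a'` is a multiple of `a`. -/
theorem exists_ipair_eq_mul {n : ℕ} {a a' : Fin n → ℤ} (ha : a ≠ 0)
    (h : ∀ x, ipair a x = 0 → ipair a' x = 0) : ∃ t : ℝ, ∀ x, ipair a' x = t * ipair a x := by
  obtain ⟨v, hv⟩ := exists_ipair_eq_one ha
  refine ⟨ipair a' v, fun x => ?_⟩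
  have := h (x - ipair a x • v) (by rw [ipair_sub, ipair_smul, hv]; ring)
  rw [ipair_sub, ipair_smul] at this
  linarith

/-- The face of `S` on which the integer functional `a` is minimal. -/
def minFace {n : ℕ} (S : Set (Fin n → ℝ)) (a : Fin n → ℤ) : Set (Fin n → ℝ) :=
  {x ∈ S | ∀ y ∈ S, ipair a x ≤ ipair a y}

theorem minFace_eq_argFace {n : ℕ} (S : Set (Fin n → ℝ)) (a : Fin n → ℤ) :
    minFace S a = argFace S (fun j => -(a j : ℝ)) := by
  ext x
  simp [minFace, argFace, ipair]

theorem SameNormalFan.minFace_eq_iff {n : ℕ} {S T : Set (Fin n → ℝ)} (h : SameNormalFan S T)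
    (a a' : Fin n → ℤ) : minFace S a = minFace S a' ↔ minFace T a = minFace T a' := by
  simp only [minFace_eq_argFace]
  exact h _ _

theorem mem_minFace_of_forall_nsmul {n : ℕ} {S : Set (Fin n → ℝ)} {a a' : Fin n → ℤ}
    {x : Fin n → ℝ} (h : ∀ N : ℕ, x ∈ minFace S (a + N • a')) : x ∈ minFace S a' := by
  refine ⟨(h 0).1, fun y hy => ?_⟩
  by_contra! hc
  obtain ⟨N, hN⟩ := exists_nat_gt ((ipair a y - ipair a x) / (ipair a' x - ipair a' y))
  have h1 := (h N).2 y hy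
  rw [add_ipair, add_ipair, nsmul_ipair, nsmul_ipair] at h1
  rw [div_lt_iff₀ (by linarith)] at hN
  nlinarith

theorem minFace_add_nsmul {n : ℕ} {S : Set (Fin n → ℝ)} {a a' : Fin n → ℤ}
    (hne : (minFace S a).Nonempty) (h : minFace S a ⊆ minFace S a') (N : ℕ) :
    minFace S (a + N • a') = minFace S a := by
  obtain ⟨p, hp⟩ := hne
  ext x
  constructor
  · rintro ⟨hx, hx'⟩
    have h1 := hx' p hp.1
    have h2 := (h hp).2 x hx
    rw [add_ipair, add_ipair, nsmul_ipair, nsmul_ipair] at h1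
    have h3 : (N : ℝ) * ipair a' p ≤ N * ipair a' x := by gcongr
    exact ⟨hx, fun y hy => by linarith [hp.2 y hy]⟩
  · intro hx
    refine ⟨hx.1, fun y hy => ?_⟩
    rw [add_ipair, add_ipair, nsmul_ipair, nsmul_ipair]
    have h3 : (N : ℝ) * ipair a' x ≤ N * ipair a' y := by
      gcongr
      exact (h hx).2 y hy
    linarith [hx.2 y hy]

/-- Optimality certificate: an integer functional `u` minimized at `p` over a polyhedron is a
nonnegative combination of the constraints active at `p`. -/
theorem exists_active_combination {n m : ℕ} {A : Fin m → Fin n → ℤ} {β : Fin m → ℝ}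
    {u : Fin n → ℤ} {p : Fin n → ℝ} (hp : ∀ i, β i ≤ ipair (A i) p)
    (hmin : ∀ y, (∀ i, β i ≤ ipair (A i) y) → ipair u p ≤ ipair u y) :
    ∃ c : Fin m → ℝ, (∀ i, 0 ≤ c i) ∧ (∀ i, ipair (A i) p ≠ β i → c i = 0) ∧
      ∀ v, ipair u v = ∑ i, c i * ipair (A i) v := by
  classical
  obtain ⟨c, h0, h1, h2⟩ := farkas (Finset.univ.filter fun i => ipair (A i) p = β i)
    (fun i => ipairL (A i)) (ipairL u) (by
      intro v hv
      have hev : ∀ᶠ ε : ℝ in nhdsWithin 0 (Set.Ioi 0), ∀ i, β i ≤ ipair (A i) (p + ε • v) := by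
        rw [Filter.eventually_all]
        intro i
        by_cases hi : ipair (A i) p = β i
        · filter_upwards [self_mem_nhdsWithin] with ε hε
          have h1 : 0 ≤ ipair (A i) v := hv i (by simp [hi])
          rw [ipair_add, ipair_smul, hi]
          have := mul_nonneg (le_of_lt (Set.mem_Ioi.mp hε)) h1
          linarith
        · have hlt : β i < ipair (A i) (p + (0 : ℝ) • v) := by
            simpa using lt_of_le_of_ne (hp i) (Ne.symm hi)
          have hc : Continuous fun ε : ℝ => ipair (A i) (p + ε • v) :=
            (continuous_ipair _).comp (by fun_prop)
          filter_upwards [mem_nhdsWithin_of_mem_nhds (hc.tendsto 0 (Ioi_mem_nhds hlt))] with ε hε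
          exact le_of_lt hε
      obtain ⟨ε, hε, hε0⟩ := (hev.and self_mem_nhdsWithin).exists
      have := hmin _ hε
      rw [ipair_add, ipair_smul] at this
      have h3 : 0 ≤ ε * ipair u v := by linarith
      exact nonneg_of_mul_nonneg_right h3 hε0)
  refine ⟨c, h0, fun i hi => h1 i (by simp [hi]), fun v => ?_⟩
  have := h2 v
  simp only [ipairL_apply] at this
  rw [this]
  refine Finset.sum_subset (Finset.filter_subset _ _) fun i _ hi => ?_
  rw [h1 i hi, zero_mul]

theorem minFace_nonempty {S : Set (Fin n → ℝ)} (hS : IsCompact S) (hne : S.Nonempty)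
    (a : Fin n → ℤ) : (minFace S a).Nonempty := by
  obtain ⟨x, hx, h⟩ := hS.exists_isMinOn hne (continuous_ipair a).continuousOn
  exact ⟨x, hx, fun y hy => h hy⟩

namespace PolyDesc

variable {n m : ℕ} (D : PolyDesc n m)

theorem mem_adj {s : ℝ} {x : Fin n → ℝ} :
    x ∈ D.adj s ↔ ∀ i, (D.b i : ℝ) + s ≤ ipair (D.A i) x := by
  simp only [adj, dist, dF, Set.mem_ofPred_eq, Finset.le_inf'_iff, Finset.mem_univ, true_imp_iff]
  exact forall_congr' fun i => by constructor <;> intro h <;> linarith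

theorem adj_subset_pts {s : ℝ} (hs : 0 ≤ s) : D.adj s ⊆ D.pts := fun x hx i => by
  have := D.mem_adj.mp hx i
  linarith

theorem isClosed_halfspaces (β : Fin m → ℝ) :
    IsClosed {x : Fin n → ℝ | ∀ i, β i ≤ ipair (D.A i) x} := by
  simp only [Set.ofPred_forall]
  exact isClosed_iInter fun i => isClosed_le continuous_const (continuous_ipair _)

theorem isCompact_pts : IsCompact D.pts :=
  Metric.isCompact_of_isClosed_isBounded (D.isClosed_halfspaces _) D.bounded

theorem isCompact_adj {s : ℝ} (hs : 0 ≤ s) : IsCompact (D.adj s) := by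
  refine D.isCompact_pts.of_isClosed_subset ?_ (D.adj_subset_pts hs)
  have : D.adj s = {x | ∀ i, (D.b i : ℝ) + s ≤ ipair (D.A i) x} := Set.ext fun x => D.mem_adj
  rw [this]
  exact D.isClosed_halfspaces _

theorem dim_pos {n m : ℕ} (D : PolyDesc n m) : 0 < n := by
  have := D.facet_dim ⟨0, D.hm⟩
  omega

theorem setDim_pts : setDim D.pts = n := D.fulldim

theorem pts_nonempty : D.pts.Nonempty := by
  by_contra! h
  have h1 := D.setDim_pts
  have h2 := D.dim_pos
  rw [h, setDim, vectorSpan_empty, finrank_bot] at h1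
  omega

/-- No nonzero integer functional is constant on a full-dimensional polytope. -/
theorem exists_ipair_ne {a : Fin n → ℤ} (ha : a ≠ 0) (β : ℝ) : ∃ x ∈ D.pts, ipair a x ≠ β := by
  by_contra! h
  have hle : vectorSpan ℝ D.pts ≤ LinearMap.ker (ipairL a) := by
    rw [vectorSpan_def, Submodule.span_le]
    rintro _ ⟨x, hx, y, hy, rfl⟩
    simp [ipair_sub, h x hx, h y hy]
  have h1 := Submodule.finrank_mono hle
  have h2 := finrank_ker_ipairL ha
  have h3 := D.setDim_pts
  rw [setDim] at h3
  omega

theorem minFace_ne_pts {a : Fin n → ℤ} (ha : a ≠ 0) : minFace D.pts a ≠ D.pts := by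
  intro h
  obtain ⟨y, hy⟩ := D.pts_nonempty
  obtain ⟨x, hx, hne⟩ := D.exists_ipair_ne ha (ipair a y)
  rw [← h] at hx hy
  exact hne (le_antisymm (hx.2 y hy.1) (hy.2 x hx.1))

theorem ker_le_vectorSpan_minFace (i : Fin m) :
    LinearMap.ker (ipairL (D.A i)) ≤ vectorSpan ℝ (minFace D.pts (D.A i)) := by
  obtain ⟨p, hp⟩ := minFace_nonempty D.isCompact_pts D.pts_nonempty (D.A i)
  have hk := finrank_ker_ipairL (D.prim i).1
  have hd := D.facet_dim i
  rw [setDim] at hd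
  set F : Set (Fin n → ℝ) := {x | (∀ j, (D.b j : ℝ) ≤ ipair (D.A j) x) ∧
    ipair (D.A i) x = (D.b i : ℝ)} with hF
  rcases F.eq_empty_or_nonempty with h | ⟨q, hq⟩
  · rw [h, vectorSpan_empty, finrank_bot] at hd
    have h0 : Module.finrank ℝ (LinearMap.ker (ipairL (D.A i))) = 0 := by omega
    rw [Submodule.finrank_eq_zero.mp h0]
    exact bot_le
  · have hFm : F ⊆ minFace D.pts (D.A i) := fun x hx =>
      ⟨hx.1, fun y hy => by rw [hx.2]; exact hy i⟩
    have hle : vectorSpan ℝ F ≤ LinearMap.ker (ipairL (D.A i)) := by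
      rw [vectorSpan_def, Submodule.span_le]
      rintro _ ⟨x, hx, y, hy, rfl⟩
      simp [ipair_sub, hx.2, hy.2]
    rw [← Submodule.eq_of_le_of_finrank_eq hle (by omega)]
    exact vectorSpan_mono ℝ hFm

/-- A primitive functional minimized on the facet with inner normal `D.A i` equals `D.A i`. -/
theorem eq_of_minFace_subset (i : Fin m) {a : Fin n → ℤ} (ha : IsPrimitive a)
    (h : minFace D.pts (D.A i) ⊆ minFace D.pts a) : a = D.A i := by
  obtain ⟨p, hp⟩ := minFace_nonempty D.isCompact_pts D.pts_nonempty (D.A i)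
  have hle : vectorSpan ℝ (minFace D.pts (D.A i)) ≤ LinearMap.ker (ipairL a) := by
    rw [vectorSpan_def, Submodule.span_le]
    rintro _ ⟨x, hx, y, hy, rfl⟩
    have := le_antisymm ((h hx).2 y hy.1) ((h hy).2 x hx.1)
    simp [ipair_sub, this]
  obtain ⟨t, ht⟩ := exists_ipair_eq_mul (D.prim i).1 fun x hx => by
    have := ((D.ker_le_vectorSpan_minFace i).trans hle) (show x ∈ LinearMap.ker _ from hx)
    simpa using this
  obtain ⟨x, hx, hne⟩ := D.exists_ipair_ne (D.prim i).1 (ipair (D.A i) p)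
  have h1 := lt_of_le_of_ne (hp.2 x hx) (Ne.symm hne)
  have h2 := (h hp).2 x hx
  rw [ht, ht] at h2
  have h3 : 0 ≤ t := by
    by_contra! hc
    nlinarith
  have h4 : t ≠ 0 := by
    rintro rfl
    obtain ⟨v, hv⟩ := exists_ipair_ne_zero ha.1
    exact hv (by rw [ht]; ring)
  refine (D.prim i).eq_of_pos_smul ha (lt_of_le_of_ne h3 h4.symm) fun j => ?_
  have := ht (Pi.single j 1)
  rwa [ipair_single, ipair_single] at this

theorem exists_forall_lt : ∃ x, ∀ i, (D.b i : ℝ) < ipair (D.A i) x := by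
  have h : ∀ i, ∃ x ∈ D.pts, ipair (D.A i) x ≠ (D.b i : ℝ) := fun i =>
    D.exists_ipair_ne (D.prim i).1 _
  choose x hx hne using h
  have hm : (0 : ℝ) < m := by exact_mod_cast D.hm
  refine ⟨(m : ℝ)⁻¹ • ∑ k, x k, fun i => ?_⟩
  rw [ipair_smul, ipair_sum, lt_inv_mul_iff₀ hm]
  calc (m : ℝ) * D.b i = ∑ _k : Fin m, (D.b i : ℝ) := by simp
    _ < ∑ k, ipair (D.A i) (x k) := Finset.sum_lt_sum (fun k _ => hx k i)
        ⟨i, Finset.mem_univ _, lt_of_le_of_ne (hx i i) (Ne.symm (hne i))⟩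

theorem exists_pos_adj_nonempty : ∃ s, s ∈ D.qcdInvSet := by
  obtain ⟨x, hx⟩ := D.exists_forall_lt
  refine ⟨D.dist x, ?_, x, D.mem_adj.mpr fun i => ?_⟩
  · simp only [dist, dF, Finset.lt_inf'_iff]
    intro i _
    linarith [hx i]
  · have : D.dist x ≤ D.dF i x := Finset.inf'_le _ (Finset.mem_univ i)
    rw [dF] at this
    linarith

theorem qcdInvSet_bddAbove : BddAbove D.qcdInvSet := by
  let i : Fin m := ⟨0, D.hm⟩
  obtain ⟨M, hM⟩ := D.isCompact_pts.bddAbove_image (continuous_ipair (D.A i)).continuousOn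
  refine ⟨M - D.b i, ?_⟩
  rintro s ⟨hs, x, hx⟩
  have h1 := hM ⟨x, D.adj_subset_pts hs.le hx, rfl⟩
  have h2 := D.mem_adj.mp hx i
  linarith

theorem qcdInv_pos : 0 < D.qcdInv := by
  obtain ⟨s, hs⟩ := D.exists_pos_adj_nonempty
  exact lt_of_lt_of_le hs.1 (le_csSup D.qcdInvSet_bddAbove hs)

theorem nefInvSet_subset_qcdInvSet : D.nefInvSet ⊆ D.qcdInvSet := by
  rintro s ⟨hs, hfan⟩
  refine ⟨hs, ?_⟩
  by_contra! h
  have ha := (D.prim ⟨0, D.hm⟩).1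
  refine D.minFace_ne_pts ha ?_
  have h0 : minFace D.pts (0 : Fin n → ℤ) = D.pts := by
    ext x
    simp [minFace, ipair]
  rw [(hfan.minFace_eq_iff _ 0).mp (by simp [h, minFace]), h0]

/-- If `P⁽ˢ⁾` has the same normal fan as `P`, then each facet inequality meeting `P` is attained
along the corresponding face of `P⁽ˢ⁾`. -/
theorem eq_of_mem_minFace_adj {s : ℝ} (hs : s ∈ D.nefInvSet) {i : Fin m} {x p : Fin n → ℝ}
    (hx : x ∈ D.pts) (hxi : ipair (D.A i) x = D.b i) (hp : p ∈ minFace (D.adj s) (D.A i)) :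
    ipair (D.A i) p = D.b i + s := by
  obtain ⟨c, h0, h1, h2⟩ := exists_active_combination (A := D.A) (β := fun k => D.b k + s)
    (u := D.A i) (p := p) (D.mem_adj.mp hp.1) fun y hy => hp.2 y (D.mem_adj.mpr hy)
  obtain ⟨k, hk⟩ : ∃ k, c k ≠ 0 := by
    by_contra! hc
    obtain ⟨v, hv⟩ := exists_ipair_ne_zero (D.prim i).1
    exact hv (by rw [h2]; simp [hc])
  have hck : 0 < c k := lt_of_le_of_ne (h0 k) hk.symm
  have hpk : ipair (D.A k) p = D.b k + s := by
    by_contra hc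
    exact hk (h1 k hc)
  have hsub : minFace (D.adj s) (D.A i) ⊆ minFace (D.adj s) (D.A k) := by
    intro q hq
    have hqp : ipair (D.A i) q = ipair (D.A i) p :=
      le_antisymm (hq.2 p hp.1) (hp.2 q hq.1)
    rw [h2, h2, ← sub_eq_zero, ← Finset.sum_sub_distrib] at hqp
    have hnn : ∀ l ∈ Finset.univ, 0 ≤ c l * ipair (D.A l) q - c l * ipair (D.A l) p := by
      intro l _
      by_cases hl : ipair (D.A l) p = D.b l + s
      · rw [← mul_sub, hl]
        exact mul_nonneg (h0 l) (sub_nonneg.mpr (D.mem_adj.mp hq.1 l))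
      · rw [h1 l hl]
        simp
    have hz := (Finset.sum_eq_zero_iff_of_nonneg hnn).mp hqp k (Finset.mem_univ _)
    rw [← mul_sub, mul_eq_zero, or_iff_right hk, sub_eq_zero] at hz
    refine ⟨hq.1, fun y hy => ?_⟩
    rw [hz, hpk]
    exact D.mem_adj.mp hy k
  have hsub' : minFace D.pts (D.A i) ⊆ minFace D.pts (D.A k) := by
    intro q hq
    refine mem_minFace_of_forall_nsmul (a := D.A i) fun N => ?_
    rwa [(hs.2.minFace_eq_iff _ _).mp (minFace_add_nsmul ⟨p, hp⟩ hsub N)]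
  have hki := D.eq_of_minFace_subset i (D.prim k) hsub'
  have hb := hx k
  rw [hki, hxi] at hb
  rw [hki] at hpk
  exact le_antisymm (by linarith) (D.mem_adj.mp hp.1 i)

/-- If `P⁽ˢ⁾` has the same normal fan as `P`, every face of `P` has a counterpart in `P⁽ˢ⁾`. -/
theorem exists_mem_adj_active {s : ℝ} (hs : s ∈ D.nefInvSet) {x : Fin n → ℝ} (hx : x ∈ D.pts) :
    ∃ p ∈ D.adj s, ∀ i ∈ D.active x, ipair (D.A i) p = D.b i + s := by
  classical
  set u : Fin n → ℤ := ∑ i with i ∈ D.active x, D.A i with hu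
  have hsub : ∀ i ∈ D.active x, minFace D.pts u ⊆ minFace D.pts (D.A i) := by
    intro i hi q hq
    have h1 := hq.2 x hx
    rw [hu, sum_ipair, sum_ipair] at h1
    have h2 : ∀ k ∈ Finset.univ.filter (· ∈ D.active x),
        ipair (D.A k) x ≤ ipair (D.A k) q := by
      intro k hk
      rw [show ipair (D.A k) x = D.b k from (Finset.mem_filter.mp hk).2]
      exact hq.1 k
    have h3 := (Finset.sum_eq_sum_iff_of_le h2).mp (le_antisymm (Finset.sum_le_sum h2) h1) i
      (by simpa using hi)
    refine ⟨hq.1, fun y hy => ?_⟩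
    rw [← h3, show ipair (D.A i) x = D.b i from hi]
    exact hy i
  have hne := minFace_nonempty D.isCompact_pts D.pts_nonempty u
  obtain ⟨p, hp⟩ := minFace_nonempty (D.isCompact_adj hs.1.le)
    (D.nefInvSet_subset_qcdInvSet hs).2 u
  refine ⟨p, hp.1, fun i hi => D.eq_of_mem_minFace_adj hs hx hi ?_⟩
  refine mem_minFace_of_forall_nsmul (a := u) fun N => ?_
  rwa [(hs.2.minFace_eq_iff _ _).mpr (minFace_add_nsmul hne (hsub i hi) N)]

end PolyDesc

theorem QNormal.nefInv_eq {n m : ℕ} {D : PolyDesc n m} (h : QNormal D) :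
    D.nefInv = D.qcdInv := (inv_injective h).symm

namespace PolyDesc

variable {n m : ℕ} (D : PolyDesc n m)

/-- For a ℚ-normal polytope, every face has a counterpart in the core. -/
theorem exists_mem_core_active (hD : QNormal D) {x : Fin n → ℝ} (hx : x ∈ D.pts) :
    ∃ q ∈ D.core, ∀ i ∈ D.active x, ipair (D.A i) q = D.b i + D.qcdInv := by
  have hne : D.nefInvSet.Nonempty := by
    by_contra! h
    have h1 := hD.nefInv_eq
    rw [nefInv, h, Real.sSup_empty] at h1
    exact D.qcdInv_pos.ne h1
  obtain ⟨s, -, hs, hmem⟩ := exists_seq_tendsto_sSup hne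
    (D.qcdInvSet_bddAbove.mono D.nefInvSet_subset_qcdInvSet)
  rw [show sSup D.nefInvSet = D.qcdInv from hD.nefInv_eq] at hs
  choose p hp hpa using fun k => D.exists_mem_adj_active (hmem k) hx
  obtain ⟨q, -, φ, hφ, hq⟩ := D.isCompact_pts.tendsto_subseq fun k =>
    D.adj_subset_pts (hmem k).1.le (hp k)
  have hs' := hs.comp hφ.tendsto_atTop
  have hA : ∀ i, Filter.Tendsto (fun k => ipair (D.A i) (p (φ k))) Filter.atTop
      (nhds (ipair (D.A i) q)) := fun i => ((continuous_ipair _).tendsto q).comp hq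
  have hB : ∀ i, Filter.Tendsto (fun k => (D.b i : ℝ) + s (φ k)) Filter.atTop
      (nhds (D.b i + D.qcdInv)) := fun i => hs'.const_add _
  refine ⟨q, D.mem_adj.mpr fun i => ?_, fun i hi => ?_⟩
  · exact le_of_tendsto_of_tendsto' (hB i) (hA i) fun k => D.mem_adj.mp (hp _) i
  · exact tendsto_nhds_unique ((hA i).congr fun k => hpa _ i hi) (hB i)

theorem core_nonempty (hD : QNormal D) : D.core.Nonempty := by
  obtain ⟨x, hx⟩ := D.pts_nonempty
  obtain ⟨q, hq, -⟩ := D.exists_mem_core_active hD hx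
  exact ⟨q, hq⟩

/-- A nonnegative combination of facet normals active at a common point that is constant on the
core only involves facets at constant minimal distance from the core. -/
theorem ipair_core_eq_of_combination (hD : QNormal D) {x : Fin n → ℝ} (hx : x ∈ D.pts)
    {c : Fin m → ℝ} (h0 : ∀ i, 0 ≤ c i) (h1 : ∀ i ∉ D.active x, c i = 0)
    (hconst : ∀ y ∈ D.core, ∀ z ∈ D.core,
      ∑ i, c i * ipair (D.A i) y = ∑ i, c i * ipair (D.A i) z)
    {i : Fin m} (hi : c i ≠ 0) {y : Fin n → ℝ} (hy : y ∈ D.core) :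
    ipair (D.A i) y = D.b i + D.qcdInv := by
  obtain ⟨q, hq, hqa⟩ := D.exists_mem_core_active hD hx
  have hle : ∀ k ∈ Finset.univ, c k * ipair (D.A k) q ≤ c k * ipair (D.A k) y := by
    intro k _
    by_cases hk : k ∈ D.active x
    · rw [hqa k hk]
      exact mul_le_mul_of_nonneg_left (D.mem_adj.mp hy k) (h0 k)
    · rw [h1 k hk]
      simp
  have h := (Finset.sum_eq_sum_iff_of_le hle).mp (hconst q hq y hy) i (Finset.mem_univ _)
  have hia : i ∈ D.active x := by
    by_contra hc
    exact hi (h1 i hc)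
  rw [← hqa i hia]
  exact (mul_left_cancel₀ hi h).symm

end PolyDesc

section Projection

variable {n n' : ℕ} {π : (Fin n → ℝ) →ₗ[ℝ] (Fin n' → ℝ)}

/-- Integer functionals pull back along a lattice projection. -/
theorem exists_ipair_pullback (hlat : π '' IntPts n = IntPts n') (z : Fin n' → ℤ) :
    ∃ ζ : Fin n → ℤ, ∀ x, ipair ζ x = ipair z (π x) := by
  have h : ∀ l : Fin n, ∃ w : Fin n' → ℤ, (fun j => (w j : ℝ)) = π (Pi.single l 1) := by
    intro l
    have : π (Pi.single l 1) ∈ IntPts n' := by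
      rw [← hlat]
      refine ⟨_, ⟨Pi.single l 1, ?_⟩, rfl⟩
      funext j
      by_cases hj : j = l
      · subst hj; simp
      · simp [Pi.single_eq_of_ne hj]
    exact this
  choose w hw using h
  refine ⟨fun l => ∑ k, z k * w l k, fun x => ?_⟩
  have hx : x = ∑ l, x l • (Pi.single l 1 : Fin n → ℝ) := by
    funext j
    simp [Finset.sum_apply, Pi.single_apply]
  conv_rhs => rw [hx, map_sum, ipair_sum]
  refine Finset.sum_congr rfl fun l _ => ?_
  rw [map_smul, ipair_smul, ← hw, mul_comm]
  simp [ipair]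

/-- Integer functionals vanishing on the kernel descend along a lattice projection. -/
theorem exists_ipair_descend (hlat : π '' IntPts n = IntPts n') {a : Fin n → ℤ}
    (ha : ∀ x, π x = 0 → ipair a x = 0) :
    ∃ α : Fin n' → ℤ, ∀ x, ipair a x = ipair α (π x) := by
  have h : ∀ k : Fin n', ∃ w : Fin n → ℤ, π (fun j => (w j : ℝ)) = Pi.single k 1 := by
    intro k
    have : (Pi.single k 1 : Fin n' → ℝ) ∈ IntPts n' := by
      refine ⟨Pi.single k 1, ?_⟩
      funext j
      by_cases hj : j = k
      · subst hj; simp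
      · simp [Pi.single_eq_of_ne hj]
    rw [← hlat] at this
    obtain ⟨_, ⟨w, rfl⟩, hw⟩ := this
    exact ⟨w, hw⟩
  choose w hw using h
  refine ⟨fun k => ∑ l, a l * w k l, fun x => ?_⟩
  have hy : π (x - ∑ k, π x k • (fun j => (w k j : ℝ))) = 0 := by
    rw [map_sub, map_sum, sub_eq_zero]
    funext j
    simp [hw, Finset.sum_apply, Pi.single_apply]
  have := ha _ hy
  rw [ipair_sub, sub_eq_zero, ipair_sum] at this
  rw [this]
  refine Finset.sum_congr rfl fun k _ => ?_
  rw [ipair_smul, mul_comm]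
  simp [ipair]

theorem IsPrimitive.descend (hlat : π '' IntPts n = IntPts n') {a : Fin n → ℤ}
    {α : Fin n' → ℤ} (ha : IsPrimitive a) (h : ∀ x, ipair a x = ipair α (π x)) :
    IsPrimitive α := by
  refine ⟨?_, fun k β hβ => ?_⟩
  · rintro rfl
    exact ha.1 (ipair_injective fun x => by rw [h]; simp [ipair])
  · obtain ⟨b, hb⟩ := exists_ipair_pullback hlat β
    exact ha.2 k b (ipair_injective fun x => by rw [h, hβ, zsmul_ipair, zsmul_ipair, hb])

end Projection

namespace PolyDesc

variable {n m : ℕ} (D : PolyDesc n m)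

theorem continuous_dist : Continuous D.dist := by
  unfold dist dF
  exact Continuous.finset_inf'_apply _ fun i _ => (continuous_ipair _).sub continuous_const

theorem dist_le (i : Fin m) (x : Fin n → ℝ) : D.dist x ≤ ipair (D.A i) x - D.b i :=
  Finset.inf'_le _ (Finset.mem_univ i)

theorem exists_dist_eq (x : Fin n → ℝ) : ∃ i, D.dist x = ipair (D.A i) x - D.b i := by
  obtain ⟨i, -, hi⟩ := Finset.exists_mem_eq_inf'
    (Finset.univ_nonempty_iff.mpr (Fin.pos_iff_nonempty.mp D.hm)) (fun i => D.dF i x)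
  exact ⟨i, hi⟩

/-- The inequalities attained on the polytope already cut it out. -/
theorem mem_pts_of_forall_attained {y₀ y : Fin n → ℝ} (h₀ : ∀ i, (D.b i : ℝ) < ipair (D.A i) y₀)
    (h : ∀ i, (∃ x ∈ D.pts, ipair (D.A i) x = D.b i) → (D.b i : ℝ) ≤ ipair (D.A i) y) :
    y ∈ D.pts := by
  by_contra hy
  set z : ℝ → Fin n → ℝ := fun t => y₀ + t • (y - y₀) with hz
  have hz0 : z 0 = y₀ := by simp [hz]
  have hz1 : z 1 = y := by simp [hz]
  have hg0 : 0 ≤ D.dist (z 0) := by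
    obtain ⟨i, hi⟩ := D.exists_dist_eq (z 0)
    rw [hi, hz0]
    linarith [h₀ i]
  have hg1 : D.dist (z 1) < 0 := by
    by_contra! hc
    refine hy fun i => ?_
    have := D.dist_le i (z 1)
    rw [hz1] at this hc
    linarith
  obtain ⟨t, ht, hgt⟩ := intermediate_value_Icc' zero_le_one
    (D.continuous_dist.comp (show Continuous z by fun_prop)).continuousOn
    ⟨hg1.le, hg0⟩
  simp only [Function.comp_apply] at hgt
  obtain ⟨i, hi⟩ := D.exists_dist_eq (z t)
  have hzt : z t ∈ D.pts := fun k => by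
    have := D.dist_le k (z t)
    linarith
  have hiy := h i ⟨z t, hzt, by linarith⟩
  have ht1 : t ≠ 1 := by
    rintro rfl
    linarith
  have hlt : t < 1 := lt_of_le_of_ne ht.2 ht1
  have e : ipair (D.A i) (z t) = ipair (D.A i) y₀ + t * (ipair (D.A i) y - ipair (D.A i) y₀) := by
    rw [hz, ipair_add, ipair_smul, ipair_sub]
  have h0i := h₀ i
  have ht0 := ht.1
  nlinarith

/-- A direction that is nonnegative on all attained inequalities vanishes. -/
theorem eq_zero_of_forall_attained {y₀ v : Fin n → ℝ}
    (h₀ : ∀ i, (D.b i : ℝ) < ipair (D.A i) y₀)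
    (h : ∀ i, (∃ x ∈ D.pts, ipair (D.A i) x = D.b i) → 0 ≤ ipair (D.A i) v) : v = 0 := by
  by_contra hv
  have hv' : 0 < ‖v‖ := norm_pos_iff.mpr hv
  have hmem : ∀ t : ℝ, 0 ≤ t → y₀ + t • v ∈ D.pts := fun t ht =>
    D.mem_pts_of_forall_attained h₀ fun i hi => by
      rw [ipair_add, ipair_smul]
      have := mul_nonneg ht (h i hi)
      linarith [h₀ i]
  obtain ⟨M, hM⟩ := D.isCompact_pts.isBounded.exists_norm_le
  have hM0 : 0 ≤ M := (norm_nonneg _).trans (hM _ (hmem 0 le_rfl))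
  have ht : 0 ≤ (M + ‖y₀‖ + 1) / ‖v‖ := by positivity
  have h1 := hM _ (hmem _ ht)
  have h2 : ‖((M + ‖y₀‖ + 1) / ‖v‖) • v‖ = M + ‖y₀‖ + 1 := by
    rw [norm_smul, Real.norm_of_nonneg ht, div_mul_cancel₀ _ hv'.ne']
  have h3 := norm_sub_le (y₀ + ((M + ‖y₀‖ + 1) / ‖v‖) • v) y₀
  rw [add_sub_cancel_left, h2] at h3
  linarith

/-- `y₀` is equidistant, at distance `s₀`, from all attained inequalities. -/
structure IsCenter (y₀ : Fin n → ℝ) (s₀ : ℝ) : Prop where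
  pos : 0 < s₀
  le : ∀ i, (D.b i : ℝ) + s₀ ≤ ipair (D.A i) y₀
  eq_of_attained : ∀ i, (∃ x ∈ D.pts, ipair (D.A i) x = D.b i) →
    ipair (D.A i) y₀ = D.b i + s₀

namespace IsCenter

variable {D} {y₀ : Fin n → ℝ} {s₀ : ℝ}

theorem lt (h : D.IsCenter y₀ s₀) (i : Fin m) : (D.b i : ℝ) < ipair (D.A i) y₀ := by
  linarith [h.le i, h.pos]

theorem eq_of_mem_adj (h : D.IsCenter y₀ s₀) {s : ℝ} (hs : s₀ ≤ s) {y : Fin n → ℝ}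
    (hy : y ∈ D.adj s) : y = y₀ := by
  refine sub_eq_zero.mp (D.eq_zero_of_forall_attained h.lt ?_)
  intro i hi
  rw [ipair_sub, h.eq_of_attained i hi]
  linarith [D.mem_adj.mp hy i]

theorem le_of_mem_qcdInvSet (h : D.IsCenter y₀ s₀) {s : ℝ} (hs : s ∈ D.qcdInvSet) :
    s ≤ s₀ := by
  by_contra! hlt
  obtain ⟨-, y, hy⟩ := hs
  obtain rfl := h.eq_of_mem_adj hlt.le hy
  obtain ⟨v, hv⟩ := exists_ipair_ne_zero (D.prim ⟨0, D.hm⟩).1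
  have hv0 : v = 0 := D.eq_zero_of_forall_attained h.lt fun i hi => by
    have h1 := h.eq_of_attained i hi
    have h2 := D.mem_adj.mp hy i
    linarith
  rw [hv0] at hv
  exact hv (by simp [ipair])

theorem qcdInv_eq (h : D.IsCenter y₀ s₀) : D.qcdInv = s₀ :=
  le_antisymm (csSup_le D.exists_pos_adj_nonempty fun _ hs => h.le_of_mem_qcdInvSet hs)
    (le_csSup D.qcdInvSet_bddAbove ⟨h.pos, y₀, D.mem_adj.mpr h.le⟩)

theorem core_eq (h : D.IsCenter y₀ s₀) : D.core = {y₀} := by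
  rw [core, h.qcdInv_eq]
  exact Set.eq_singleton_iff_unique_mem.mpr
    ⟨D.mem_adj.mpr h.le, fun y hy => h.eq_of_mem_adj le_rfl hy⟩

/-- The adjoint polytopes are homothetic to the polytope with centre `y₀`. -/
theorem mem_adj_iff (h : D.IsCenter y₀ s₀) {s : ℝ} (hs : 0 < s) (hs' : s < s₀)
    {y : Fin n → ℝ} : y ∈ D.adj s ↔ y₀ + (s₀ / (s₀ - s)) • (y - y₀) ∈ D.pts := by
  have hd : 0 < s₀ - s := sub_pos.mpr hs'
  have hs₀ := h.pos
  set r : ℝ := s₀ / (s₀ - s) with hr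
  have hr0 : 0 < r := div_pos hs₀ hd
  have hrm : r * (s₀ - s) = s₀ := div_mul_cancel₀ _ hd.ne'
  constructor
  · intro hy
    refine D.mem_pts_of_forall_attained h.lt fun i hi => ?_
    have h1 := h.eq_of_attained i hi
    have h2 := D.mem_adj.mp hy i
    rw [ipair_add, ipair_smul, ipair_sub]
    have h3 : r * (s - s₀) ≤ r * (ipair (D.A i) y - ipair (D.A i) y₀) :=
      mul_le_mul_of_nonneg_left (by linarith) hr0.le
    linarith
  · intro hy
    refine D.mem_adj.mpr fun i => ?_
    have h1 := h.le i
    have h2 := hy i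
    rw [ipair_add, ipair_smul, ipair_sub] at h2
    have h3 : 0 ≤ r * (ipair (D.A i) y - D.b i - s) := by
      have hr1 : 1 ≤ r := by
        rw [hr, le_div_iff₀ hd]
        linarith
      nlinarith
    linarith [nonneg_of_mul_nonneg_right h3 hr0]

theorem sameNormalFan_adj (h : D.IsCenter y₀ s₀) {s : ℝ} (hs : 0 < s) (hs' : s < s₀) :
    SameNormalFan (D.adj s) D.pts := by
  have hr0 : 0 < s₀ / (s₀ - s) := div_pos h.pos (sub_pos.mpr hs')
  set r : ℝ := s₀ / (s₀ - s) with hr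
  set f : (Fin n → ℝ) → (Fin n → ℝ) := fun y => y₀ + r • (y - y₀) with hf
  have hsurj : Function.Surjective f := fun z =>
    ⟨y₀ + r⁻¹ • (z - y₀), by simp [hf, smul_smul, mul_inv_cancel₀ hr0.ne']⟩
  have hmem : ∀ y, y ∈ D.adj s ↔ f y ∈ D.pts := fun y => h.mem_adj_iff hs hs'
  have hdot : ∀ (u y : Fin n → ℝ),
      ∑ j, u j * f y j = ∑ j, u j * y₀ j + r * (∑ j, u j * y j - ∑ j, u j * y₀ j) := by
    intro u y
    rw [← Finset.sum_sub_distrib, Finset.mul_sum, ← Finset.sum_add_distrib]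
    refine Finset.sum_congr rfl fun j _ => ?_
    simp only [hf, Pi.add_apply, Pi.smul_apply, Pi.sub_apply, smul_eq_mul]
    ring
  have hpre : ∀ u, argFace (D.adj s) u = Set.preimage f (argFace D.pts u) := by
    intro u
    ext y
    have hiff : ∀ y y' : Fin n → ℝ, ∑ j, u j * y j ≤ ∑ j, u j * y' j ↔
        ∑ j, u j * f y j ≤ ∑ j, u j * f y' j := by
      intro y y'
      rw [hdot, hdot, add_le_add_iff_left, mul_le_mul_iff_right₀ hr0, sub_le_sub_iff_right]
    constructor
    · rintro ⟨hy, hmax⟩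
      refine ⟨(hmem y).mp hy, fun z hz => ?_⟩
      obtain ⟨z, rfl⟩ := hsurj z
      exact (hiff z y).mp (hmax z ((hmem z).mpr hz))
    · rintro ⟨hy, hmax⟩
      exact ⟨(hmem y).mpr hy, fun z hz => (hiff z y).mpr (hmax _ ((hmem z).mp hz))⟩
  intro u v
  rw [hpre, hpre]
  exact hsurj.preimage_injective.eq_iff

theorem nefInv_eq (h : D.IsCenter y₀ s₀) : D.nefInv = s₀ := by
  have hIoo : ∀ s, 0 < s → s < s₀ → s ∈ D.nefInvSet := fun s hs hs' =>
    ⟨hs, h.sameNormalFan_adj hs hs'⟩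
  have hub : ∀ s ∈ D.nefInvSet, s ≤ s₀ := fun s hs =>
    h.le_of_mem_qcdInvSet (D.nefInvSet_subset_qcdInvSet hs)
  have hpos := h.pos
  refine csSup_eq_of_forall_le_of_forall_lt_exists_gt
    ⟨s₀ / 2, hIoo _ (by linarith) (by linarith)⟩ hub fun w hw => ?_
  refine ⟨(max w 0 + s₀) / 2, hIoo _ ?_ ?_, ?_⟩
  · linarith [le_max_right w 0]
  · linarith [max_lt hw hpos]
  · linarith [le_max_left w 0, max_lt hw hpos]

end IsCenter

end PolyDesc

section Main

variable {n m n' m' : ℕ} {D : PolyDesc n m} {D' : PolyDesc n' m'}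
  {π : (Fin n → ℝ) →ₗ[ℝ] (Fin n' → ℝ)}

/-- The projection along the core direction identifies any two core points. -/
theorem map_eq_of_mem_core (hker : LinearMap.ker π = vectorSpan ℝ D.core) {x y : Fin n → ℝ}
    (hx : x ∈ D.core) (hy : y ∈ D.core) : π x = π y := by
  have : x - y ∈ LinearMap.ker π := by
    rw [hker]
    exact vsub_mem_vectorSpan ℝ hx hy
  rwa [LinearMap.mem_ker, map_sub, sub_eq_zero] at this

/-- Functionals that are constant on the core factor through the projection. -/
theorem ipair_eq_zero_of_constant (hker : LinearMap.ker π = vectorSpan ℝ D.core)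
    {a : Fin n → ℤ} {β : ℝ} (ha : ∀ y ∈ D.core, ipair a y = β) {x : Fin n → ℝ}
    (hx : π x = 0) : ipair a x = 0 := by
  have hle : vectorSpan ℝ D.core ≤ LinearMap.ker (ipairL a) := by
    rw [vectorSpan_def, Submodule.span_le]
    rintro _ ⟨y, hy, z, hz, rfl⟩
    simp [ipair_sub, ha y hy, ha z hz]
  have hx' : x ∈ vectorSpan ℝ D.core := by
    rw [← hker]
    exact hx
  simpa using hle hx'

/-- Every inequality of the projected polytope comes from an inequality of the original one that
is at constant minimal distance from the core. -/
theorem exists_lift_row (hQN : QNormal D) (hker : LinearMap.ker π = vectorSpan ℝ D.core)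
    (hlat : π '' IntPts n = IntPts n') (hQ : D'.pts = π '' D.pts) (j : Fin m') :
    ∃ i, (∀ x, ipair (D.A i) x = ipair (D'.A j) (π x)) ∧
      (∀ y ∈ D.core, ipair (D.A i) y = D.b i + D.qcdInv) ∧
      ∃ x ∈ D.pts, ipair (D.A i) x = D.b i := by
  obtain ⟨u, hu⟩ := exists_ipair_pullback hlat (D'.A j)
  obtain ⟨x, hx⟩ := minFace_nonempty D.isCompact_pts D.pts_nonempty u
  obtain ⟨c, h0, h1, h2⟩ := exists_active_combination (A := D.A) (β := fun i => (D.b i : ℝ))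
    (u := u) (p := x) hx.1 fun y hy => hx.2 y hy
  obtain ⟨i, hi⟩ : ∃ i, c i ≠ 0 := by
    by_contra! hc
    obtain ⟨y, hy⟩ := D'.pts_nonempty
    obtain ⟨w, hw, hne⟩ := D'.exists_ipair_ne (D'.prim j).1 0
    rw [hQ] at hw
    obtain ⟨w, -, rfl⟩ := hw
    exact hne (by rw [← hu, h2]; simp [hc])
  have hcore : ∀ y ∈ D.core, ipair (D.A i) y = D.b i + D.qcdInv := fun y hy =>
    D.ipair_core_eq_of_combination hQN hx.1 h0 h1 (fun y hy z hz => by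
      rw [← h2, ← h2, hu, hu, map_eq_of_mem_core hker hy hz]) hi hy
  have hxi : ipair (D.A i) x = D.b i := by
    by_contra hc
    exact hi (h1 i hc)
  obtain ⟨α, hα⟩ := exists_ipair_descend hlat fun x hx =>
    ipair_eq_zero_of_constant hker hcore hx
  have hsub : minFace D'.pts (D'.A j) ⊆ minFace D'.pts α := by
    rintro y ⟨hy, hmin⟩
    refine ⟨hy, fun w hw => ?_⟩
    rw [hQ] at hy hw
    obtain ⟨y, hy, rfl⟩ := hy
    obtain ⟨w, hw, rfl⟩ := hw
    have hyx := hmin (π x) (hQ ▸ ⟨x, hx.1, rfl⟩)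
    rw [← hu, ← hu, h2, h2] at hyx
    have hle : ∀ k ∈ Finset.univ, c k * ipair (D.A k) x ≤ c k * ipair (D.A k) y := by
      intro k _
      by_cases hk : ipair (D.A k) x = D.b k
      · rw [hk]
        exact mul_le_mul_of_nonneg_left (hy k) (h0 k)
      · rw [h1 k hk]
        simp
    have h := (Finset.sum_eq_sum_iff_of_le hle).mp
      (le_antisymm (Finset.sum_le_sum hle) hyx) i (Finset.mem_univ _)
    rw [← hα, ← hα, ← mul_left_cancel₀ hi h, hxi]
    exact hw i
  obtain rfl := D'.eq_of_minFace_subset j ((D.prim i).descend hlat hα) hsub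
  exact ⟨i, hα, hcore, x, hx.1, hxi⟩

/-- For attained inequalities, the lifted inequality has the same right hand side. -/
theorem exists_lift_attained_row (hQN : QNormal D)
    (hker : LinearMap.ker π = vectorSpan ℝ D.core)
    (hlat : π '' IntPts n = IntPts n') (hQ : D'.pts = π '' D.pts) {j : Fin m'}
    (hj : ∃ y ∈ D'.pts, ipair (D'.A j) y = D'.b j) :
    ∃ i, (∀ x, ipair (D.A i) x = ipair (D'.A j) (π x)) ∧ (D.b i : ℝ) = D'.b j ∧
      ∀ y ∈ D.core, ipair (D.A i) y = D.b i + D.qcdInv := by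
  obtain ⟨i, hi, hcore, x, hx, hxi⟩ := exists_lift_row hQN hker hlat hQ j
  refine ⟨i, hi, ?_, hcore⟩
  obtain ⟨y, hy, hyj⟩ := hj
  rw [hQ] at hy
  obtain ⟨y, hy, rfl⟩ := hy
  have h1 := hy i
  have hxQ : π x ∈ D'.pts := hQ ▸ ⟨x, hx, rfl⟩
  have h2 := hxQ j
  rw [← hi] at h2 hyj
  linarith

/-- The image of the core is a centre of the projected polytope. -/
theorem isCenter_map (hQN : QNormal D) (hker : LinearMap.ker π = vectorSpan ℝ D.core)
    (hlat : π '' IntPts n = IntPts n') (hQ : D'.pts = π '' D.pts) {x₀ : Fin n → ℝ}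
    (hx₀ : x₀ ∈ D.core) : D'.IsCenter (π x₀) D.qcdInv where
  pos := D.qcdInv_pos
  le j := by
    obtain ⟨i, hi, hcore, x, hx, hxi⟩ := exists_lift_row hQN hker hlat hQ j
    have hxQ : π x ∈ D'.pts := hQ ▸ ⟨x, hx, rfl⟩
    have h2 := hxQ j
    rw [← hi] at h2
    rw [← hi, hcore x₀ hx₀]
    linarith
  eq_of_attained j hj := by
    obtain ⟨i, hi, hb, hcore⟩ := exists_lift_attained_row hQN hker hlat hQ hj
    rw [← hi, hcore x₀ hx₀, hb]

/-- A combination of facet normals, in coordinates and as an identity of functionals. -/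
theorem coord_eq_sum_iff (z : Fin n → ℤ) (c : Fin m → ℝ) :
    ((fun j => (z j : ℝ)) = ∑ i, c i • (fun j => (D.A i j : ℝ))) ↔
      ∀ x, ipair z x = ∑ i, c i * ipair (D.A i) x := by
  constructor
  · intro h x
    have hj : ∀ j, (z j : ℝ) = ∑ i, c i * D.A i j := fun j => by
      simpa [Finset.sum_apply] using congrFun h j
    simp only [ipair, hj, Finset.mul_sum, Finset.sum_mul, mul_assoc]
    exact Finset.sum_comm
  · intro h
    funext j
    have := h (Pi.single j 1)
    simpa [ipair_single, Finset.sum_apply] using this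

/-- If all facets in the support of a combination that are active at `x` are at distance `s` from
`x₀`, then the sum of coefficients is determined by the values at `x` and `x₀`. -/
theorem sum_coeff_mul_eq {z : Fin n → ℤ} {c : Fin m → ℝ} {x x₀ : Fin n → ℝ} {s : ℝ}
    (h1 : ∀ i ∉ D.active x, c i = 0)
    (h2 : ∀ x, ipair z x = ∑ i, c i * ipair (D.A i) x)
    (h3 : ∀ i ∈ D.active x, c i ≠ 0 → ipair (D.A i) x₀ = D.b i + s) :
    (∑ i, c i) * s = ipair z x₀ - ipair z x := by
  rw [h2, h2, ← Finset.sum_sub_distrib, Finset.sum_mul]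
  refine Finset.sum_congr rfl fun i _ => ?_
  by_cases hi : i ∈ D.active x
  · by_cases hc : c i = 0
    · simp [hc]
    · rw [h3 i hi hc, show ipair (D.A i) x = D.b i from hi]
      ring
  · simp [h1 i hi]

theorem AlphaCanonical.map (hQN : QNormal D) (hker : LinearMap.ker π = vectorSpan ℝ D.core)
    (hlat : π '' IntPts n = IntPts n') (hsurj : Function.Surjective π)
    (hQ : D'.pts = π '' D.pts) {α : ℝ} (hα : AlphaCanonical D α) : AlphaCanonical D' α := by
  classical
  obtain ⟨x₀, hx₀⟩ := D.core_nonempty hQN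
  have hcen := isCenter_map hQN hker hlat hQ hx₀
  intro y hy z hz ⟨e, he0, he1, he2⟩
  rw [coord_eq_sum_iff] at he2
  have hyQ := hy
  rw [hQ] at hyQ
  obtain ⟨x, hx, rfl⟩ := hyQ
  obtain ⟨ζ, hζ⟩ := exists_ipair_pullback hlat z
  have hζ0 : ζ ≠ 0 := by
    rintro rfl
    refine hz (ipair_injective fun w => ?_)
    obtain ⟨v, rfl⟩ := hsurj w
    rw [← hζ]
    simp [ipair]
  have hs₀ := D.qcdInv_pos
  set t : ℝ := (ipair z (π x₀) - ipair z (π x)) / D.qcdInv with ht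
  have hD' : coneHeight D' (D'.active (π x)) (fun j => (z j : ℝ)) = t := by
    have : {t : ℝ | ∃ c : Fin m' → ℝ, (∀ i, 0 ≤ c i) ∧ (∀ i ∉ D'.active (π x), c i = 0) ∧
        ((fun j => (z j : ℝ)) = ∑ i, c i • (fun j => ((D'.A i j : ℝ)))) ∧ t = ∑ i, c i} = {t} := by
      have huniq : ∀ c : Fin m' → ℝ, (∀ i ∉ D'.active (π x), c i = 0) →
          (∀ w, ipair z w = ∑ i, c i * ipair (D'.A i) w) → ∑ i, c i = t := by
        intro c h1 h2
        rw [ht, eq_div_iff hs₀.ne']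
        exact sum_coeff_mul_eq h1 h2 fun i hi _ => hcen.eq_of_attained i ⟨_, hy, hi⟩
      ext r
      constructor
      · rintro ⟨c, -, h1, h2, rfl⟩
        exact huniq c h1 ((coord_eq_sum_iff _ _).mp h2)
      · rintro rfl
        exact ⟨e, he0, he1, (coord_eq_sum_iff _ _).mpr he2, (huniq e he1 he2).symm⟩
    rw [coneHeight, this, csSup_singleton]
  have hrow : ∀ j, ∃ i, j ∈ D'.active (π x) →
      i ∈ D.active x ∧ ∀ v, ipair (D.A i) v = ipair (D'.A j) (π v) := by
    intro j
    by_cases hj : j ∈ D'.active (π x)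
    · obtain ⟨i, hi, hb, -⟩ := exists_lift_attained_row hQN hker hlat hQ ⟨_, hy, hj⟩
      refine ⟨i, fun _ => ⟨?_, hi⟩⟩
      change ipair (D.A i) x = D.b i
      rw [hi, hb]
      exact hj
    · exact ⟨⟨0, D.hm⟩, fun h => absurd h hj⟩
  choose φ hφ using hrow
  have hrep : ∃ c : Fin m → ℝ, (∀ i, 0 ≤ c i) ∧ (∀ i ∉ D.active x, c i = 0) ∧
      ((fun j => (ζ j : ℝ)) = ∑ i, c i • (fun j => ((D.A i j : ℝ)))) := by
    refine ⟨fun i => ∑ j with φ j = i, e j, fun i => Finset.sum_nonneg fun j _ => he0 j,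
      fun i hi => Finset.sum_eq_zero fun j hj => ?_, (coord_eq_sum_iff _ _).mpr fun v => ?_⟩
    · by_contra hc
      have hja : j ∈ D'.active (π x) := by
        by_contra hja
        exact hc (he1 j hja)
      rw [Finset.mem_filter] at hj
      exact hi (hj.2 ▸ (hφ j hja).1)
    · have hterm : ∀ j, e j * ipair (D'.A j) (π v) = e j * ipair (D.A (φ j)) v := by
        intro j
        by_cases hj : j ∈ D'.active (π x)
        · rw [(hφ j hj).2]
        · simp [he1 j hj]
      rw [hζ, he2]
      simp only [hterm]
      rw [← Finset.sum_fiberwise Finset.univ φ]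
      refine Finset.sum_congr rfl fun i _ => ?_
      rw [Finset.sum_mul]
      refine Finset.sum_congr rfl fun j hj => ?_
      rw [(Finset.mem_filter.mp hj).2]
  rw [hD']
  refine (hα x hx ζ hζ0 hrep).trans ?_
  obtain ⟨c, hc⟩ := hrep
  refine csSup_le ⟨_, c, hc.1, hc.2.1, hc.2.2, rfl⟩ ?_
  rintro r ⟨c, h0, h1, h2, rfl⟩
  rw [coord_eq_sum_iff] at h2
  rw [ht, ← hζ, ← hζ]
  refine ((eq_div_iff hs₀.ne').mpr (sum_coeff_mul_eq h1 h2 fun i _ hi => ?_)).le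
  exact D.ipair_core_eq_of_combination hQN hx h0 h1 (fun y hy w hw => by
    rw [← h2, ← h2, hζ, hζ, map_eq_of_mem_core hker hy hw]) hi hx₀

end Main

/-- Suppose `P` is ℚ-normal, i.e. `μ(P) = τ(P)`. Let
`π : ℝⁿ → ℝⁿ/K(P)` be the natural projection, realized as a surjective linear map
`π : ℝⁿ → ℝ^{n'}` with kernel `K(P)` mapping `ℤⁿ` onto `ℤ^{n'}`. Then the image
`Q = π(P)` (with any irredundant facet description `D'`) is ℚ-normal, `core(Q)` is
the single point `π(core(P))`, and `μ(Q) = μ(P)`. Moreover, if `P` is `α`-canonical,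
then `Q` is `α`-canonical. -/
theorem statement11 {n m n' : ℕ} (D : PolyDesc n m) (hQN : QNormal D)
    (π : (Fin n → ℝ) →ₗ[ℝ] (Fin n' → ℝ))
    (hsurj : Function.Surjective π)
    (hker : LinearMap.ker π = vectorSpan ℝ D.core)
    (hlat : π '' IntPts n = IntPts n')
    {m' : ℕ} (D' : PolyDesc n' m') (hQ : D'.pts = π '' D.pts) :
    QNormal D' ∧
    (∃ y : Fin n' → ℝ, π '' D.core = {y} ∧ D'.core = {y}) ∧
    D'.qcd = D.qcd ∧
    (∀ α : ℝ, 0 < α → AlphaCanonical D α → AlphaCanonical D' α) := by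
  obtain ⟨x₀, hx₀⟩ := D.core_nonempty hQN
  have hcen := isCenter_map hQN hker hlat hQ hx₀
  refine ⟨?_, ⟨π x₀, ?_, hcen.core_eq⟩, ?_, fun α _ hα => hα.map hQN hker hlat hsurj hQ⟩
  · rw [QNormal, PolyDesc.qcd, PolyDesc.nefVal, hcen.qcdInv_eq, hcen.nefInv_eq]
  · refine Set.eq_singleton_iff_unique_mem.mpr ⟨⟨x₀, hx₀, rfl⟩, ?_⟩
    rintro _ ⟨x, hx, rfl⟩
    exact map_eq_of_mem_core hker hx hx₀
  · rw [PolyDesc.qcd, PolyDesc.qcd, hcen.qcdInv_eq]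

end
end

section
/- Let P be an n-dimensional lattice polytope with cd(P) > ⌈(n+1)/2⌉. Then through every vertex of P there is an edge whose only lattice points are its two vertices. -/
open scoped BigOperators Pointwise

noncomputable section

section EdgesAtVertex

open scoped NNReal

variable {E : Type*} [AddCommGroup E] [Module ℝ E]

/-- A span over `ℝ≥0` is closed under multiplication by nonnegative reals. -/
lemma real_smul_mem_span_nnreal {t : Set E} {a : ℝ} (ha : 0 ≤ a) {x : E}
    (hx : x ∈ Submodule.span ℝ≥0 t) : a • x ∈ Submodule.span ℝ≥0 t := by
  lift a to ℝ≥0 using ha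
  exact Submodule.smul_mem _ a hx

/-- A finite set of vectors contains an irredundant set of generators of the convex cone
it spans. -/
lemma exists_irredundant_cone_generators {s : Set E} (hs : s.Finite) :
    ∃ t ⊆ s, Submodule.span ℝ≥0 t = Submodule.span ℝ≥0 s ∧
      ∀ d ∈ t, d ∉ Submodule.span ℝ≥0 (t \ {d}) := by
  have hfin : {t : Set E | t ⊆ s ∧ Submodule.span ℝ≥0 t = Submodule.span ℝ≥0 s}.Finite :=
    hs.finite_subsets.subset fun t ht => ht.1
  obtain ⟨t, ht⟩ := hfin.exists_minimal ⟨s, subset_rfl, rfl⟩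
  refine ⟨t, ht.prop.1, ht.prop.2, fun d hd hmem => ?_⟩
  have hspan : Submodule.span ℝ≥0 (t \ {d}) = Submodule.span ℝ≥0 s := by
    rw [← ht.prop.2]
    refine le_antisymm (Submodule.span_mono Set.sdiff_subset) (Submodule.span_le.2 fun x hx => ?_)
    by_cases hxd : x = d
    · exact hxd ▸ hmem
    · exact Submodule.subset_span ⟨hx, hxd⟩
  exact (ht.le_of_le ⟨Set.sdiff_subset.trans ht.prop.1, hspan⟩ Set.sdiff_subset hd).2 rfl

/-- In a salient cone, each member of an irredundant generating set spans an extremal ray. -/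
lemma exists_smul_eq_of_add_eq_smul {t : Set E}
    (hsal : ∀ x ∈ Submodule.span ℝ≥0 t, -x ∈ Submodule.span ℝ≥0 t → x = 0)
    {d : E} (hd : d ∈ t) (hirr : d ∉ Submodule.span ℝ≥0 (t \ {d})) {a b : E}
    (ha : a ∈ Submodule.span ℝ≥0 t) (hb : b ∈ Submodule.span ℝ≥0 t) {r : ℝ}
    (hab : a + b = r • d) : ∃ α : ℝ, 0 ≤ α ∧ a = α • d := by
  have hle : Submodule.span ℝ≥0 (t \ {d}) ≤ Submodule.span ℝ≥0 t :=
    Submodule.span_mono Set.sdiff_subset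
  rw [← Set.insert_sdiff_self_of_mem hd, Submodule.mem_span_insert] at ha hb
  obtain ⟨α, a', ha', rfl⟩ := ha
  obtain ⟨β, b', hb', rfl⟩ := hb
  refine ⟨α, α.2, ?_⟩
  simp only [NNReal.smul_def] at hab ⊢
  have hsum : a' + b' = (r - α - β) • d := by
    rw [sub_smul, sub_smul, ← hab]; abel
  rcases lt_or_ge 0 (r - α - β) with hpos | hneg
  · refine absurd ?_ hirr
    have := real_smul_mem_span_nnreal (inv_pos.2 hpos).le (Submodule.add_mem _ ha' hb')
    rwa [hsum, inv_smul_smul₀ hpos.ne'] at this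
  · have hz : a' = 0 := by
      refine hsal a' (hle ha') ?_
      have hmem : (-(r - α - β)) • d + b' ∈ Submodule.span ℝ≥0 t :=
        Submodule.add_mem _
          (real_smul_mem_span_nnreal (by linarith) (Submodule.subset_span hd)) (hle hb')
      convert hmem using 1
      rw [neg_smul, ← hsum]
      abel
    rw [hz, add_zero]

/-- The cone spanned by a convex set consists of the nonnegative multiples of its points. -/
lemma exists_smul_sub_of_mem_span {P : Set E} (hP : Convex ℝ P) {v : E} (hv : v ∈ P) {x : E}
    (hx : x ∈ Submodule.span ℝ≥0 ((fun p => p - v) '' P)) :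
    ∃ s : ℝ, 0 ≤ s ∧ ∃ p ∈ P, x = s • (p - v) := by
  induction hx using Submodule.span_induction with
  | mem x hx =>
    obtain ⟨p, hp, rfl⟩ := hx
    exact ⟨1, zero_le_one, p, hp, (one_smul _ _).symm⟩
  | zero => exact ⟨0, le_rfl, v, hv, (zero_smul _ _).symm⟩
  | add x y _ _ hx hy =>
    obtain ⟨s, hs, p, hp, rfl⟩ := hx
    obtain ⟨t, ht, q, hq, rfl⟩ := hy
    rcases (add_nonneg hs ht).eq_or_lt with h0 | hpos
    · obtain rfl : s = 0 := by linarith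
      obtain rfl : t = 0 := by linarith
      exact ⟨0, le_rfl, v, hv, by simp⟩
    · refine ⟨s + t, hpos.le, (s / (s + t)) • p + (t / (s + t)) • q,
        hP hp hq (by positivity) (by positivity) (by field_simp), ?_⟩
      rw [smul_sub (s + t), smul_add (s + t), smul_smul, smul_smul, mul_div_cancel₀ _ hpos.ne',
        mul_div_cancel₀ _ hpos.ne']
      module
  | smul a x _ hx =>
    obtain ⟨s, hs, p, hp, rfl⟩ := hx
    exact ⟨a * s, mul_nonneg a.2 hs, p, hp, by rw [NNReal.smul_def, smul_smul]⟩

/-- The cone of a convex set at an extreme point is salient. -/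
lemma eq_zero_of_mem_span_of_neg_mem_span {P : Set E} (hP : Convex ℝ P) {v : E}
    (hv : v ∈ Set.extremePoints ℝ P) {x : E}
    (hx : x ∈ Submodule.span ℝ≥0 ((fun p => p - v) '' P))
    (hx' : -x ∈ Submodule.span ℝ≥0 ((fun p => p - v) '' P)) : x = 0 := by
  obtain ⟨s, hs, p, hp, rfl⟩ := exists_smul_sub_of_mem_span hP hv.1 hx
  obtain ⟨t, ht, q, hq, hq'⟩ := exists_smul_sub_of_mem_span hP hv.1 hx'
  rcases hs.eq_or_lt with rfl | hs
  · simp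
  rcases ht.eq_or_lt with rfl | ht
  · simpa using hq'
  have hst : 0 < s + t := add_pos hs ht
  have hmem : v ∈ openSegment ℝ p q := by
    refine ⟨s / (s + t), t / (s + t), by positivity, by positivity, by field_simp, ?_⟩
    have h : s • p + t • q = (s + t) • v := by
      have : s • (p - v) + t • (q - v) = 0 := by rw [← hq']; abel
      rw [← sub_eq_zero, ← this]
      module
    rw [div_eq_inv_mul, div_eq_inv_mul, mul_smul, mul_smul, ← smul_add, h,
      inv_smul_smul₀ hst.ne']
  rw [hv.2 hp hq hmem, sub_self, smul_zero]

end EdgesAtVertex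

/-- Far endpoints of the edges of `P` emanating from `v`. -/
def edgeEnds {E : Type*} [AddCommGroup E] [Module ℝ E] (P : Set E) (v : E) : Set E :=
  {w | w ∈ Set.extremePoints ℝ P ∧ w ≠ v ∧ IsExtreme ℝ P (segment ℝ v w)}

section EdgeEnds

open scoped NNReal

variable {E : Type*} [NormedAddCommGroup E] [NormedSpace ℝ E]

/-- On a ray from a point of a compact set there is a last point of the set. -/
lemma exists_isGreatest_ray {P : Set E} (hP : IsCompact P) {v d : E} (hv : v ∈ P) (hd : d ≠ 0) :
    ∃ t, IsGreatest {t : ℝ | v + t • d ∈ P} t := by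
  have hcl : IsClosed {t : ℝ | v + t • d ∈ P} :=
    hP.isClosed.preimage (f := fun t : ℝ => v + t • d) (by fun_prop)
  have hne : {t : ℝ | v + t • d ∈ P}.Nonempty := ⟨0, by simpa using hv⟩
  obtain ⟨R, hR⟩ := hP.isBounded.exists_norm_le
  have hbdd : BddAbove {t : ℝ | v + t • d ∈ P} := by
    refine ⟨(R + ‖v‖) / ‖d‖, fun t ht => ?_⟩
    rw [le_div_iff₀ (norm_pos_iff.2 hd)]
    calc t * ‖d‖ ≤ ‖t • d‖ := by
          rw [norm_smul]; gcongr; exact le_abs_self t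
      _ = ‖(v + t • d) - v‖ := by rw [add_sub_cancel_left]
      _ ≤ ‖v + t • d‖ + ‖v‖ := norm_sub_le _ _
      _ ≤ R + ‖v‖ := by gcongr; exact hR _ ht
  exact ⟨_, hcl.csSup_mem hne hbdd, fun t ht => le_csSup hbdd ht⟩

/-- An extremal direction of a compact convex set at the point `v` carries an edge. -/
lemma exists_edgeEnd_of_extremal {P : Set E} (hc : IsCompact P) {v d : E}
    (hv : v ∈ P) (hd : d ≠ 0) (hvd : v + d ∈ P) (hconv : Convex ℝ P)
    (hext : ∀ x ∈ P, ∀ y ∈ P, ∀ z ∈ openSegment ℝ x y, (∃ r : ℝ, z = v + r • d) →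
      ∃ α : ℝ, 0 ≤ α ∧ x = v + α • d) :
    ∃ t : ℝ, 0 < t ∧ v + t • d ∈ edgeEnds P v := by
  obtain ⟨t, htP, hmax⟩ := exists_isGreatest_ray hc hv hd
  have ht1 : 1 ≤ t := hmax (by simpa using hvd)
  have ht0 : 0 < t := zero_lt_one.trans_le ht1
  have htP : v + t • d ∈ P := htP
  refine ⟨t, ht0, ⟨htP, ?_⟩, by simp [ht0.ne', hd],
    hconv.segment_subset hv htP, ?_⟩
  · intro x hx y hy hz
    obtain ⟨α, -, rfl⟩ := hext x hx y hy _ hz ⟨t, rfl⟩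
    obtain ⟨β, -, rfl⟩ := hext y hy _ hx _ (by rwa [openSegment_symm]) ⟨t, rfl⟩
    have hα : α ≤ t := hmax hx
    have hβ : β ≤ t := hmax hy
    obtain ⟨a, b, ha, hb, hab, hz⟩ := hz
    have h : (a * α + b * β - t) • d = 0 := by
      have : a • (v + α • d) + b • (v + β • d) = (a + b) • v + (a * α + b * β) • d := by module
      rw [this, hab, one_smul, add_right_inj] at hz
      rw [sub_smul, hz, sub_self]
    have h0 : a * α + b * β - t = 0 := (smul_eq_zero.1 h).resolve_right hd
    obtain rfl : b = 1 - a := by linarith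
    obtain rfl : α = t := by nlinarith
    rfl
  · intro x hx y hy z hz hzo
    obtain ⟨α, hα, rfl⟩ := hext x hx y hy z hzo (by
      rw [segment_eq_image'] at hz
      obtain ⟨θ, -, rfl⟩ := hz
      exact ⟨θ * t, by simp [smul_smul]⟩)
    have hαt : α ≤ t := hmax hx
    rw [segment_eq_image']
    refine ⟨α / t, ⟨by positivity, (div_le_one ht0).2 hαt⟩, ?_⟩
    simp [div_mul_cancel₀ _ ht0.ne', smul_smul]

/-- The edge directions at a vertex of a polytope span the directions of the polytope. -/
lemma vectorSpan_le_span_edgeEnds {s : Set E} (hs : s.Finite) {v : E}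
    (hv : v ∈ Set.extremePoints ℝ (convexHull ℝ s)) :
    vectorSpan ℝ (convexHull ℝ s) ≤
      Submodule.span ℝ ((fun w => w - v) '' edgeEnds (convexHull ℝ s) v) := by
  set P := convexHull ℝ s with hPdef
  have hconv : Convex ℝ P := convex_convexHull ℝ s
  have hcompact : IsCompact P := hs.isCompact_convexHull ℝ
  obtain ⟨t, hts, hspan, hirr⟩ :=
    exists_irredundant_cone_generators (hs.image fun p => p - v)
  have hPC : ∀ p ∈ P, p - v ∈ Submodule.span ℝ≥0 t := by
    have hC : Convex ℝ {p | p - v ∈ Submodule.span ℝ≥0 t} := by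
      intro x hx y hy a b ha hb hab
      rw [Set.mem_ofPred_eq] at hx hy ⊢
      convert Submodule.add_mem _ (real_smul_mem_span_nnreal ha hx)
        (real_smul_mem_span_nnreal hb hy) using 1
      obtain rfl : a = 1 - b := by linarith
      module
    refine fun p hp => convexHull_min (fun x hx => ?_) hC hp
    rw [Set.mem_ofPred_eq, hspan]
    exact Submodule.subset_span ⟨x, hx, rfl⟩
  have hCP : Submodule.span ℝ≥0 t ≤ Submodule.span ℝ≥0 ((fun p => p - v) '' P) :=
    Submodule.span_mono (hts.trans (Set.image_mono (subset_convexHull ℝ s)))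
  have hsal : ∀ x ∈ Submodule.span ℝ≥0 t, -x ∈ Submodule.span ℝ≥0 t → x = 0 := fun x hx hx' =>
    eq_zero_of_mem_span_of_neg_mem_span hconv hv (hCP hx) (hCP hx')
  have hedge : ∀ d ∈ t, d ∈ Submodule.span ℝ ((fun w => w - v) '' edgeEnds P v) := by
    intro d hd
    have hd0 : d ≠ 0 := by
      rintro rfl
      exact hirr 0 hd (Submodule.zero_mem _)
    obtain ⟨p, hp, hpd⟩ := hts hd
    have hvd : v + d ∈ P := by
      rw [← hpd]
      simpa using subset_convexHull ℝ s hp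
    obtain ⟨r, hr, hmem⟩ := exists_edgeEnd_of_extremal hcompact hv.1 hd0 hvd hconv (by
      rintro x hx y hy z ⟨a, b, ha, hb, hab, hz⟩ ⟨r, rfl⟩
      obtain ⟨α, hα, hxα⟩ := exists_smul_eq_of_add_eq_smul hsal hd (hirr d hd) (r := r)
        (real_smul_mem_span_nnreal ha.le (hPC x hx))
        (real_smul_mem_span_nnreal hb.le (hPC y hy)) (by
          rw [eq_comm, ← add_right_inj v, ← hz]
          obtain rfl : a = 1 - b := by linarith
          module)
      refine ⟨a⁻¹ * α, by positivity, ?_⟩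
      rw [mul_smul, ← hxα, inv_smul_smul₀ ha.ne']
      abel)
    have := Submodule.smul_mem _ r⁻¹ (Submodule.subset_span (R := ℝ) (Set.mem_image_of_mem
      (fun w => w - v) hmem))
    simpa [smul_smul, inv_mul_cancel₀ hr.ne'] using this
  rw [vectorSpan_eq_span_vsub_set_right ℝ hv.1, Submodule.span_le]
  rintro _ ⟨p, hp, rfl⟩
  have hle : Submodule.span ℝ≥0 t ≤
      (Submodule.span ℝ ((fun w => w - v) '' edgeEnds P v)).restrictScalars ℝ≥0 :=
    Submodule.span_le.2 hedge
  exact hle (hPC p hp)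

/-- Positive combinations of total weight less than one of a basis of directions
`w i - v` lie in the interior of a convex set containing `v` and the `w i`. -/
lemma add_sum_smul_mem_interior [FiniteDimensional ℝ E] {ι : Type*} [Fintype ι] {P : Set E}
    (hP : Convex ℝ P) {v : E} (hv : v ∈ P) (B : Module.Basis ι ℝ E) (hB : ∀ i, v + B i ∈ P)
    {c : ι → ℝ} (hc : ∀ i, 0 < c i) (hc1 : ∑ i, c i < 1) :
    v + ∑ i, c i • B i ∈ interior P := by
  have hcont : ∀ i, Continuous fun x => B.repr (x - v) i := fun i =>
    (LinearMap.continuous_of_finiteDimensional (B.coord i)).comp (continuous_id.sub continuous_const)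
  refine mem_interior.2 ⟨{x | (∀ i, 0 < B.repr (x - v) i) ∧ ∑ i, B.repr (x - v) i < 1}, ?_, ?_, ?_⟩
  · rintro x ⟨hx, hx1⟩
    have hsum : ∑ o : Option ι,
        (o.elim (1 - ∑ i, B.repr (x - v) i) fun i => B.repr (x - v) i) = 1 := by
      simp [Fintype.sum_option]
    have := hP.sum_mem (t := Finset.univ)
      (z := fun o : Option ι => o.elim v fun i => v + B i)
      (w := fun o : Option ι => o.elim (1 - ∑ i, B.repr (x - v) i) fun i => B.repr (x - v) i)
      (by rintro (_ | i) -
          · simpa using hx1.le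
          · exact (hx i).le) hsum
      (by rintro (_ | i) -
          · exact hv
          · exact hB i)
    convert this using 1
    simp only [Fintype.sum_option, Option.elim, smul_add, Finset.sum_add_distrib,
      ← Finset.sum_smul, B.sum_repr]
    module
  · rw [Set.ofPred_and, Set.ofPred_forall]
    refine IsOpen.inter ?_ (isOpen_lt (continuous_finsetSum _ fun i _ => hcont i) continuous_const)
    exact isOpen_iInter_of_finite fun i => isOpen_lt continuous_const (hcont i)
  · have h : ∀ i, B.repr (v + ∑ i, c i • B i - v) i = c i := fun i => by
      rw [add_sub_cancel_left, B.repr_sum_self]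
    simp only [Set.mem_ofPred_eq, h]
    exact ⟨hc, hc1⟩

end EdgeEnds

/-- The integer points form a subgroup. -/
def intPtsAddSubgroup (n : ℕ) : AddSubgroup (Fin n → ℝ) where
  carrier := IntPts n
  zero_mem' := ⟨0, by ext; simp⟩
  add_mem' := by
    rintro _ _ ⟨a, rfl⟩ ⟨b, rfl⟩
    exact ⟨a + b, by ext; simp⟩
  neg_mem' := by
    rintro _ ⟨a, rfl⟩
    exact ⟨-a, by ext; simp⟩

/-- A lattice segment with a lattice point besides its endpoints has one in the half next to
either endpoint. -/
lemma exists_smul_mem_intPts {n : ℕ} {v w : Fin n → ℝ} (hv : v ∈ IntPts n) (hw : w ∈ IntPts n)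
    (h : segment ℝ v w ∩ IntPts n ≠ {v, w}) :
    ∃ s : ℝ, 0 < s ∧ s ≤ 1 / 2 ∧ s • (w - v) ∈ IntPts n := by
  have hsub : {v, w} ⊆ segment ℝ v w ∩ IntPts n := by
    rintro x (rfl | rfl)
    · exact ⟨left_mem_segment ℝ _ _, hv⟩
    · exact ⟨right_mem_segment ℝ _ _, hw⟩
  obtain ⟨q, ⟨hq, hqZ⟩, hqn⟩ := Set.exists_of_ssubset (hsub.ssubset_of_ne h.symm)
  rw [segment_eq_image'] at hq
  obtain ⟨θ, ⟨h0, h1⟩, rfl⟩ := hq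
  have hθ0 : θ ≠ 0 := by rintro rfl; simp at hqn
  have hθ1 : θ ≠ 1 := by rintro rfl; simp at hqn
  have hmem : θ • (w - v) ∈ intPtsAddSubgroup n := by
    simpa using (intPtsAddSubgroup n).sub_mem hqZ hv
  rcases le_total θ (1 / 2) with hle | hge
  · exact ⟨θ, h0.lt_of_ne' hθ0, hle, hmem⟩
  · refine ⟨1 - θ, sub_pos.2 (h1.lt_of_ne hθ1), by linarith, ?_⟩
    rw [sub_smul, one_smul]
    exact (intPtsAddSubgroup n).sub_mem ((intPtsAddSubgroup n).sub_mem hw hv) hmem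

/-- Let `P` be an `n`-dimensional lattice polytope with
`cd(P) > ⌈(n+1)/2⌉`. Then through every vertex of `P` there is an edge (a
one-dimensional face, i.e. a segment between two distinct vertices which is an
extreme subset of `P`) whose only lattice points are its two vertices. -/
theorem statement13 {n : ℕ} (V : Finset (Fin n → ℤ)) (P : Set (Fin n → ℝ))
    (hP : P = convexHull ℝ
      ((fun z : Fin n → ℤ => fun j => ((z j : ℝ))) '' (V : Set (Fin n → ℤ))))
    (hdim : setDim P = n)
    (hcd : (⌈((n : ℚ) + 1) / 2⌉ : ℤ) < (codegS P : ℤ)) :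
    ∀ v ∈ Set.extremePoints ℝ P, ∃ w ∈ Set.extremePoints ℝ P, w ≠ v ∧
      IsExtreme ℝ P (segment ℝ v w) ∧
      segment ℝ v w ∩ IntPts n = {v, w} := by
  subst hP
  set P := convexHull ℝ ((fun z : Fin n → ℤ => fun j => ((z j : ℝ))) '' (V : Set (Fin n → ℤ)))
  intro v hv
  by_contra! hcon
  have hlat : ∀ x ∈ Set.extremePoints ℝ P, x ∈ IntPts n := fun x hx =>
    Set.image_subset_range _ _ (extremePoints_convexHull_subset hx)
  have hedge : ∀ w ∈ edgeEnds P v, ∃ s : ℝ, 0 < s ∧ s ≤ 1 / 2 ∧ s • (w - v) ∈ IntPts n :=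
    fun w hw => exists_smul_mem_intPts (hlat v hv) (hlat w hw.1) (hcon w hw.1 hw.2.1 hw.2.2)
  have htop : Submodule.span ℝ ((fun w => w - v) '' edgeEnds P v) = ⊤ := by
    have hvs : vectorSpan ℝ P = ⊤ :=
      Submodule.eq_top_of_finrank_eq (by simpa [setDim] using hdim)
    exact top_le_iff.1 (hvs ▸ vectorSpan_le_span_edgeEnds (V.finite_toSet.image _) hv)
  obtain ⟨b, hb, hbspan, hbli⟩ :=
    exists_linearIndependent ℝ ((fun w => w - v) '' edgeEnds P v)
  have : Fintype b := hbli.setFinite.fintype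
  let B : Module.Basis b ℝ (Fin n → ℝ) :=
    Module.Basis.mk hbli (by rw [Subtype.range_coe, hbspan, htop])
  have hcard : Fintype.card b = n := by
    simpa using (Module.finrank_eq_card_basis B).symm
  have hB : ∀ i, v + B i ∈ edgeEnds P v := fun i => by
    obtain ⟨w, hw, hwi⟩ := hb i.2
    have hBi : B i = w - v := (Module.Basis.mk_apply _ _ _).trans hwi.symm
    rwa [hBi, add_sub_cancel]
  have hs : ∀ i, ∃ s : ℝ, 0 < s ∧ s ≤ 1 / 2 ∧ s • B i ∈ IntPts n := fun i => by
    simpa using hedge _ (hB i)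
  choose s hs0 hs2 hsZ using hs
  set k := n / 2 + 1 with hk
  have hk0 : (0 : ℝ) < k := by positivity
  have hnk : (n : ℝ) / 2 < k := by
    have : n < 2 * k := by omega
    have : (n : ℝ) < 2 * k := by exact_mod_cast this
    linarith
  have hint : v + ∑ i, (s i / k) • B i ∈ interior P := by
    refine add_sum_smul_mem_interior (convex_convexHull ℝ _) hv.1 B (fun i => (hB i).1.1)
      (fun i => div_pos (hs0 i) hk0) ?_
    rw [← Finset.sum_div, div_lt_one hk0]
    calc ∑ i, s i ≤ ∑ _i : b, (1 / 2 : ℝ) := Finset.sum_le_sum fun i _ => hs2 i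
      _ = n / 2 := by simp [hcard]; ring
      _ < k := hnk
  have hZ : (k : ℝ) • (v + ∑ i, (s i / k) • B i) ∈ intPtsAddSubgroup n := by
    rw [smul_add, Finset.smul_sum, Nat.cast_smul_eq_nsmul]
    refine add_mem (nsmul_mem (hlat v hv) k) (sum_mem fun i _ => ?_)
    rw [smul_smul, mul_div_cancel₀ _ hk0.ne']
    exact hsZ i
  obtain ⟨z, hz⟩ := hZ
  have hle : codegS P ≤ k := by
    refine Nat.sInf_le ⟨Nat.succ_pos _, z, ?_⟩
    rw [interior_smul₀ hk0.ne']
    exact Set.mem_of_eq_of_mem hz (Set.smul_mem_smul_set hint)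
  have hceil : (k : ℤ) ≤ ⌈((n : ℚ) + 1) / 2⌉ := by
    rw [Int.le_ceil_iff]
    have : 2 * k ≤ n + 2 := by omega
    have : (2 : ℚ) * k ≤ n + 2 := by exact_mod_cast this
    push_cast
    linarith
  omega

end
end

section
/- Let P be an n-dimensional lattice polytope that is not unimodularly equivalent to Δ_n. If n > d(P), then P is a Cayley polytope of length n − m + 1 for some m ≤ d(P); that is, P is unimodularly equivalent to a Cayley sum P_0 * ⋯ * P_t of lattice polytopes P_0,…,P_t ⊆ ℝ^m with m ≤ d(P) and t = n − m. -/
open scoped BigOperators Pointwise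

noncomputable section

theorem exists_dual_weights {ι : Type*} [Fintype ι] [Nonempty ι] {n : ℕ}
    (a : ι → Fin n → ℝ) (b : ι → ℝ) (s : ℝ)
    (hs : ∀ r, (∃ x, ∀ i, r ≤ a i ⬝ᵥ x - b i) → r ≤ s) :
    ∃ w : ι → ℝ, (∀ i, 0 ≤ w i) ∧ ∑ i, w i = 1 ∧ ∑ i, w i • a i = 0 ∧
      -∑ i, w i * b i ≤ s := by
  classical
  set q : ι → (Fin n → ℝ) × ℝ := fun i => (a i, -b i) with hq
  set K : Set ((Fin n → ℝ) × ℝ) := convexHull ℝ (Set.range q) with hK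
  set M : Set ((Fin n → ℝ) × ℝ) := {0} ×ˢ Set.Iic s with hM
  have hKc : IsCompact K := (Set.finite_range q).isCompact_convexHull (𝕜 := ℝ)
  have hMc : IsClosed M := isClosed_singleton.prod isClosed_Iic
  have hMconv : Convex ℝ M := (convex_singleton 0).prod (convex_Iic s)
  by_cases hdisj : Disjoint K M
  · exfalso
    obtain ⟨f, u, v, hfu, huv, hfv⟩ :=
      geometric_hahn_banach_compact_closed (convex_convexHull ℝ _) hKc hMconv hMc hdisj
    set τ : ℝ := f (0, 1) with hτ
    set y : Fin n → ℝ := fun j => f (Pi.single j 1, 0) with hy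
    have hf : ∀ p r, f (p, r) = p ⬝ᵥ y + r * τ := by
      intro p r
      have h1 : ((p, r) : (Fin n → ℝ) × ℝ) =
          ∑ j, p j • ((Pi.single j 1, 0) : (Fin n → ℝ) × ℝ) + r • (0, 1) := by
        ext k
        · simp [Prod.fst_sum, Finset.sum_apply, Pi.single_apply]
        · simp [Prod.snd_sum]
      rw [h1, map_add, map_sum]
      simp only [map_smul, smul_eq_mul, dotProduct, hy, hτ]
    have hK' : ∀ i, a i ⬝ᵥ y - b i * τ < u := by
      intro i
      have := hfu (q i) (subset_convexHull ℝ _ ⟨i, rfl⟩)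
      rw [hq, hf] at this
      linarith
    have hM' : ∀ r ≤ s, v < r * τ := by
      intro r hr
      have := hfv (0, r) ⟨rfl, hr⟩
      rw [hf] at this
      simpa using this
    have hτ0 : τ ≤ 0 := by
      by_contra! h
      have := hM' (min s (v / τ)) (min_le_left _ _)
      have h2 : min s (v / τ) * τ ≤ v / τ * τ :=
        mul_le_mul_of_nonneg_right (min_le_right _ _) h.le
      rw [div_mul_cancel₀ _ h.ne'] at h2
      linarith
    rcases hτ0.lt_or_eq with hneg | h0
    · have hvs := hM' s le_rfl
      have : u / τ ≤ s := by
        apply hs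
        refine ⟨τ⁻¹ • y, fun i => ?_⟩
        rw [dotProduct_smul, smul_eq_mul, div_le_iff_of_neg hneg]
        have h3 : (τ⁻¹ * (a i ⬝ᵥ y) - b i) * τ = a i ⬝ᵥ y - b i * τ := by
          have := hneg.ne
          field_simp
        rw [h3]
        exact (hK' i).le
      rw [div_le_iff_of_neg hneg] at this
      linarith
    · have hv := hM' s le_rfl
      rw [h0] at hv
      have hpos : ∀ i, 0 < a i ⬝ᵥ (-y) := by
        intro i
        have := hK' i
        rw [h0] at this
        rw [dotProduct_neg]
        linarith
      have hev : ∀ᶠ r : ℝ in Filter.atTop, ∀ i, s + 1 ≤ a i ⬝ᵥ (r • (-y)) - b i := by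
        rw [Filter.eventually_all]
        intro i
        filter_upwards [Filter.eventually_ge_atTop ((s + 1 + b i) / (a i ⬝ᵥ (-y)))] with r hr
        rw [div_le_iff₀ (hpos i)] at hr
        rw [dotProduct_smul, smul_eq_mul]
        linarith
      obtain ⟨r, hr⟩ := hev.exists
      have := hs (s + 1) ⟨_, hr⟩
      linarith
  · rw [Set.not_disjoint_iff] at hdisj
    obtain ⟨p, hpK, hpM⟩ := hdisj
    rw [hK, convexHull_range_eq_exists_affineCombination] at hpK
    obtain ⟨t, w, hw0, hw1, hwp⟩ := hpK
    rw [Finset.affineCombination_eq_linear_combination _ _ _ hw1] at hwp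
    have key : ∀ {X : Type} [AddCommMonoid X] [Module ℝ X] (g : ι → X),
        ∑ i, (if i ∈ t then w i else 0) • g i = ∑ i ∈ t, w i • g i := by
      intro X _ _ g
      simp [ite_smul, Finset.sum_ite_mem]
    refine ⟨fun i => if i ∈ t then w i else 0, fun i => ?_, ?_, ?_, ?_⟩
    · dsimp only
      split_ifs with h
      exacts [hw0 i h, le_rfl]
    · simpa [Finset.sum_ite_mem] using hw1
    · rw [key a]
      have := congrArg Prod.fst hwp
      rw [hpM.1] at this
      simpa [Prod.fst_sum, hq] using this
    · have h1 := key b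
      simp only [smul_eq_mul] at h1
      rw [h1]
      have := congrArg Prod.snd hwp
      have h2 : p.2 ≤ s := hpM.2
      rw [← this] at h2
      simpa [Prod.snd_sum, hq] using h2

theorem exists_linearIndepOn_support {ι W : Type*} [Fintype ι] [AddCommGroup W] [Module ℝ W]
    (q : ι → W) (hq : ∀ g : ι → ℝ, (∀ i, 0 ≤ g i) → ∑ i, g i • q i = 0 → g = 0)
    (c : ι → ℝ) (hc : ∀ i, 0 ≤ c i) :
    ∃ c' : ι → ℝ, (∀ i, 0 ≤ c' i) ∧ ∑ i, c' i • q i = ∑ i, c i • q i ∧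
      ∑ i, c i ≤ ∑ i, c' i ∧ LinearIndepOn ℝ q {i | c' i ≠ 0} := by
  classical
  induction hN : (Finset.univ.filter fun i => c i ≠ 0).card using Nat.strong_induction_on
    generalizing c with
  | _ N ih =>
  by_cases hli : LinearIndepOn ℝ q {i | c i ≠ 0}
  · exact ⟨c, hc, rfl, le_rfl, hli⟩
  have hS : ((Finset.univ.filter fun i => c i ≠ 0 : Finset ι) : Set ι) = {i | c i ≠ 0} := by
    ext; simp
  rw [← hS, linearIndepOn_finset_iff] at hli
  push Not at hli
  obtain ⟨g₀, hg₀, i₀, hi₀, hgi₀⟩ := hli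
  set g₁ : ι → ℝ := fun i => if c i ≠ 0 then g₀ i else 0 with hg₁
  have hg₁q : ∑ i, g₁ i • q i = 0 := by
    rw [← hg₀, Finset.sum_filter]
    refine Finset.sum_congr rfl fun i _ => ?_
    simp only [hg₁]
    split_ifs <;> simp
  have hg₁0 : g₁ ≠ 0 := by
    intro h
    have := congrFun h i₀
    simp only [Finset.mem_filter] at hi₀
    simp only [hg₁, if_pos hi₀.2] at this
    exact hgi₀ this
  have hg₁s : ∀ i, c i = 0 → g₁ i = 0 := by
    intro i hi; simp [hg₁, hi]
  obtain ⟨g, hgq, hg0, hgs, hgsum⟩ : ∃ g : ι → ℝ, ∑ i, g i • q i = 0 ∧ g ≠ 0 ∧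
      (∀ i, c i = 0 → g i = 0) ∧ 0 ≤ ∑ i, g i := by
    rcases le_total 0 (∑ i, g₁ i) with h | h
    · exact ⟨g₁, hg₁q, hg₁0, hg₁s, h⟩
    · refine ⟨-g₁, by simp [hg₁q], by simpa using hg₁0, fun i hi => by simp [hg₁s i hi], ?_⟩
      simpa using h
  have hneg : (Finset.univ.filter fun i => g i < 0).Nonempty := by
    by_contra h
    rw [Finset.not_nonempty_iff_eq_empty, Finset.filter_eq_empty_iff] at h
    exact hg0 (hq g (fun i => not_lt.1 (h (Finset.mem_univ i))) hgq)
  obtain ⟨k, hk, hkmin⟩ := Finset.exists_min_image _ (fun i => c i / (-g i)) hneg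
  simp only [Finset.mem_filter, Finset.mem_univ, true_and] at hk hkmin
  set r : ℝ := c k / (-g k) with hr
  have hr0 : 0 ≤ r := div_nonneg (hc k) (by linarith)
  have hrk : c k + r * g k = 0 := by
    have := hk.ne
    rw [hr, div_neg, neg_mul, div_mul_cancel₀ _ this, add_neg_cancel]
  have hnn : ∀ i, 0 ≤ c i + r * g i := by
    intro i
    rcases lt_or_ge (g i) 0 with h | h
    · have := hkmin i h
      rw [le_div_iff₀ (by linarith)] at this
      linarith
    · have := hc i
      positivity
  have hck : c k ≠ 0 := fun h => by
    have := hgs k h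
    linarith
  have hlt : (Finset.univ.filter fun i => c i + r * g i ≠ 0).card < N := by
    rw [← hN]
    apply Finset.card_lt_card
    rw [Finset.ssubset_iff_of_subset]
    · exact ⟨k, by simpa using hck, by simpa using hrk⟩
    · intro i
      simp only [Finset.mem_filter, Finset.mem_univ, true_and]
      intro h h'
      exact h (by rw [hgs i h', h']; simp)
  obtain ⟨c', h1, h2, h3, h4⟩ := ih _ hlt (fun i => c i + r * g i) hnn rfl
  refine ⟨c', h1, ?_, ?_, h4⟩
  · rw [h2]
    simp only [add_smul, mul_smul, Finset.sum_add_distrib, ← Finset.smul_sum, hgq]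
    simp
  · refine le_trans ?_ h3
    rw [Finset.sum_add_distrib, ← Finset.mul_sum]
    have := mul_nonneg hr0 hgsum
    linarith

/-- Real coordinates of an integer vector. -/
abbrev intVec {n : ℕ} (z : Fin n → ℤ) : Fin n → ℝ := fun j => (z j : ℝ)

/-- Integral affine functions `x_j - y_j`, nonnegative on `V` and not vanishing identically
on `V`, that sum up to `1` on `V`. -/
structure IsLatticePartition {n : ℕ} (V : Finset (Fin n → ℤ)) {κ : Type*} [Fintype κ]
    (x : κ → Fin n → ℤ) (y : κ → ℤ) : Prop where
  nonneg : ∀ j, ∀ v ∈ V, 0 ≤ x j ⬝ᵥ v - y j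
  sum_eq_one : ∀ v ∈ V, ∑ j, (x j ⬝ᵥ v - y j) = 1
  exists_ne_zero : ∀ j, ∃ v ∈ V, x j ⬝ᵥ v - y j ≠ 0

namespace IsLatticePartition

variable {n : ℕ} {V : Finset (Fin n → ℤ)} {κ κ' : Type*} [Fintype κ] [Fintype κ']
  {x : κ → Fin n → ℤ} {y : κ → ℤ}

theorem reindex (h : IsLatticePartition V x y) (e : κ' ≃ κ) :
    IsLatticePartition V (x ∘ e) (y ∘ e) where
  nonneg j := h.nonneg (e j)
  sum_eq_one v hv := by
    rw [← h.sum_eq_one v hv]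
    exact e.sum_comp (fun j => x j ⬝ᵥ v - y j)
  exists_ne_zero j := h.exists_ne_zero (e j)

theorem eq_ite_of_ne_zero [DecidableEq κ] (h : IsLatticePartition V x y) {v : Fin n → ℤ}
    (hv : v ∈ V) {j : κ} (hj : x j ⬝ᵥ v - y j ≠ 0) (i : κ) :
    x i ⬝ᵥ v - y i = if i = j then 1 else 0 := by
  have h1 := h.sum_eq_one v hv
  have h0 := fun i => h.nonneg i v hv
  have hj1 : 1 ≤ x j ⬝ᵥ v - y j := by have := h0 j; omega
  rw [← Finset.add_sum_erase _ _ (Finset.mem_univ j)] at h1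
  have hr : 0 ≤ ∑ i ∈ Finset.univ.erase j, (x i ⬝ᵥ v - y i) := Finset.sum_nonneg fun i _ => h0 i
  split_ifs with hij
  · subst hij; omega
  · have h2 : ∑ i ∈ Finset.univ.erase j, (x i ⬝ᵥ v - y i) = 0 := by omega
    exact (Finset.sum_eq_zero_iff_of_nonneg fun i _ => h0 i).1 h2 i (by simp [hij])

theorem exists_ne_zero_of_mem (h : IsLatticePartition V x y) {v : Fin n → ℤ}
    (hv : v ∈ V) : ∃ j, x j ⬝ᵥ v - y j ≠ 0 := by
  by_contra! h0
  have := h.sum_eq_one v hv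
  simp [h0] at this

end IsLatticePartition

/-- The extension to `ℝⁿ → ℝᵐ` of a homomorphism `ℤⁿ → ℤᵐ`. -/
def realExt {n m : ℕ} (g : (Fin n → ℤ) →ₗ[ℤ] (Fin m → ℤ)) : (Fin n → ℝ) →ₗ[ℝ] (Fin m → ℝ) :=
  ((LinearMap.toMatrix' g).map (Int.castRingHom ℝ)).mulVecLin

section realExt

variable {n m k : ℕ}

theorem realExt_intVec (g : (Fin n → ℤ) →ₗ[ℤ] (Fin m → ℤ)) (z : Fin n → ℤ) :
    realExt g (intVec z) = intVec (g z) := by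
  have h := LinearMap.toMatrix'_mulVec g z
  funext i
  rw [← h]
  simp only [realExt, Matrix.mulVecLin_apply, Matrix.mulVec, dotProduct, Matrix.map_apply,
    intVec]
  push_cast
  rfl

theorem realExt_comp (g : (Fin m → ℤ) →ₗ[ℤ] (Fin k → ℤ)) (h : (Fin n → ℤ) →ₗ[ℤ] (Fin m → ℤ)) :
    realExt (g ∘ₗ h) = realExt g ∘ₗ realExt h := by
  rw [realExt, LinearMap.toMatrix'_comp, Matrix.map_mul, Matrix.mulVecLin_mul]
  rfl

theorem realExt_id : realExt (LinearMap.id : (Fin n → ℤ) →ₗ[ℤ] _) = LinearMap.id := by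
  rw [realExt, LinearMap.toMatrix'_id, Matrix.map_one _ (map_zero _) (map_one _),
    Matrix.mulVecLin_one]

theorem realExt_zero : realExt (0 : (Fin n → ℤ) →ₗ[ℤ] (Fin m → ℤ)) = 0 := by
  rw [realExt, map_zero, Matrix.map_zero _ (map_zero _), Matrix.mulVecLin_zero]

theorem realExt_add (g h : (Fin n → ℤ) →ₗ[ℤ] (Fin m → ℤ)) :
    realExt (g + h) = realExt g + realExt h := by
  rw [realExt, map_add, Matrix.map_add _ (map_add _), Matrix.mulVecLin_add]
  rfl

/-- The extension to real vector spaces of an isomorphism `ℤⁿ ≅ ℤᵐ × ℤᵏ`. -/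
def realExtEquiv (φ : (Fin n → ℤ) ≃ₗ[ℤ] (Fin m → ℤ) × (Fin k → ℤ)) :
    (Fin n → ℝ) ≃ₗ[ℝ] (Fin m → ℝ) × (Fin k → ℝ) :=
  LinearEquiv.ofLinearMap
    ((realExt (LinearMap.fst ℤ _ _ ∘ₗ φ.toLinearMap)).prod
      (realExt (LinearMap.snd ℤ _ _ ∘ₗ φ.toLinearMap)))
    ((realExt (φ.symm.toLinearMap ∘ₗ LinearMap.inl ℤ _ _)).coprod
      (realExt (φ.symm.toLinearMap ∘ₗ LinearMap.inr ℤ _ _)))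
    (by
      have h1 : ∀ (m' k' : ℕ) (p : (Fin m → ℤ) × (Fin k → ℤ) →ₗ[ℤ] (Fin m' → ℤ))
          (i : (Fin k' → ℤ) →ₗ[ℤ] (Fin m → ℤ) × (Fin k → ℤ)),
          realExt (p ∘ₗ φ.toLinearMap) ∘ₗ realExt (φ.symm.toLinearMap ∘ₗ i) =
            realExt (p ∘ₗ i) := by
        intro m' k' p i
        rw [← realExt_comp]
        congr 1
        ext x
        simp
      have h11 := h1 m m (LinearMap.fst ℤ _ _) (LinearMap.inl ℤ _ _)
      have h12 := h1 m k (LinearMap.fst ℤ _ _) (LinearMap.inr ℤ _ _)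
      have h21 := h1 k m (LinearMap.snd ℤ _ _) (LinearMap.inl ℤ _ _)
      have h22 := h1 k k (LinearMap.snd ℤ _ _) (LinearMap.inr ℤ _ _)
      rw [LinearMap.fst_comp_inl, realExt_id] at h11
      rw [LinearMap.fst_comp_inr, realExt_zero] at h12
      rw [LinearMap.snd_comp_inl, realExt_zero] at h21
      rw [LinearMap.snd_comp_inr, realExt_id] at h22
      refine LinearMap.ext fun ⟨p, r⟩ => ?_
      have e11 := LinearMap.congr_fun h11 p
      have e12 := LinearMap.congr_fun h12 r
      have e21 := LinearMap.congr_fun h21 p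
      have e22 := LinearMap.congr_fun h22 r
      simp only [LinearMap.comp_apply, LinearMap.id_apply, LinearMap.zero_apply] at e11 e12 e21 e22
      simp only [LinearMap.comp_apply, LinearMap.prod_apply, Function.prod,
        LinearMap.coprod_apply, map_add, LinearMap.id_apply, e11, e12, e21, e22,
        Prod.mk_add_mk, add_zero, zero_add])
    (by
      rw [LinearMap.coprod_comp_prod, ← realExt_comp, ← realExt_comp, ← realExt_add,
        ← realExt_id]
      congr 1
      refine LinearMap.ext fun z => ?_
      simp only [LinearMap.add_apply, LinearMap.comp_apply, ← map_add]
      simp)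

theorem realExtEquiv_intVec (φ : (Fin n → ℤ) ≃ₗ[ℤ] (Fin m → ℤ) × (Fin k → ℤ))
    (z : Fin n → ℤ) : realExtEquiv φ (intVec z) = (intVec (φ z).1, intVec (φ z).2) := by
  change (realExt _ (intVec z), realExt _ (intVec z)) = _
  rw [realExt_intVec, realExt_intVec]
  rfl

end realExt

theorem exists_linearEquiv_snd_eq {n t : ℕ} (p : (Fin n → ℤ) →ₗ[ℤ] (Fin t → ℤ))
    (hp : Function.Surjective p) :
    ∃ k : ℕ, k + t = n ∧ ∃ φ : (Fin n → ℤ) ≃ₗ[ℤ] (Fin k → ℤ) × (Fin t → ℤ),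
      ∀ z, (φ z).2 = p z := by
  obtain ⟨s, hs⟩ := Module.projective_lifting_property p LinearMap.id hp
  have hs' : ∀ w, p (s w) = w := fun w => LinearMap.congr_fun hs w
  let ψ : (Fin n → ℤ) ≃ₗ[ℤ] LinearMap.ker p × (Fin t → ℤ) :=
    LinearEquiv.ofLinearMap
      (((LinearMap.id - s ∘ₗ p).codRestrict (LinearMap.ker p) (fun z => by simp [hs'])).prod p)
      ((LinearMap.ker p).subtype.coprod s)
      (by
        refine LinearMap.ext fun ⟨z, w⟩ => ?_
        have hz : p z = 0 := z.2
        ext <;> simp [hs', hz])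
      (by
        refine LinearMap.ext fun z => ?_
        simp)
  let b := Module.finBasis ℤ (LinearMap.ker p)
  let φ := ψ.trans (b.equivFun.prodCongr (LinearEquiv.refl ℤ (Fin t → ℤ)))
  refine ⟨_, ?_, φ, fun z => rfl⟩
  have := φ.finrank_eq
  simpa using this.symm

theorem convexHull_iUnion_convexHull_prod_singleton {ι E F : Type*} [AddCommGroup E]
    [Module ℝ E] [AddCommGroup F] [Module ℝ F] (S : ι → Set E) (e : ι → F) :
    convexHull ℝ (⋃ j, convexHull ℝ (S j) ×ˢ ({e j} : Set F)) =
      convexHull ℝ (⋃ j, S j ×ˢ ({e j} : Set F)) := by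
  refine Set.Subset.antisymm (convexHull_min (Set.iUnion_subset fun j => ?_)
    (convex_convexHull ℝ _)) (convexHull_mono (Set.iUnion_mono fun j =>
      Set.prod_mono (subset_convexHull ℝ _) le_rfl))
  have h := convexHull_prod (R := ℝ) (S j) {e j}
  rw [convexHull_singleton] at h
  rw [← h]
  exact convexHull_mono (Set.subset_iUnion (fun j => S j ×ˢ ({e j} : Set F)) j)

theorem cayleyVec_zero (t : ℕ) : cayleyVec t 0 = 0 := by
  simp [cayleyVec]

theorem cayleyVec_succ (t : ℕ) (i : Fin t) : cayleyVec t i.succ = stdBasisVec t i := by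
  simp [cayleyVec]

theorem IsLatticePartition.exists_isCayley {n t : ℕ} {V : Finset (Fin n → ℤ)}
    {x : Fin (t + 1) → Fin n → ℤ} {y : Fin (t + 1) → ℤ} (h : IsLatticePartition V x y) :
    ∃ k, IsCayley (convexHull ℝ (intVec '' (V : Set (Fin n → ℤ)))) k t := by
  classical
  choose v hvV hv using h.exists_ne_zero
  have hval : ∀ j i, x i ⬝ᵥ v j - y i = if i = j then 1 else 0 :=
    fun j i => h.eq_ite_of_ne_zero (hvV j) (hv j) i
  let p : (Fin n → ℤ) →ₗ[ℤ] (Fin t → ℤ) := (Matrix.of fun i : Fin t => x i.succ).mulVecLin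
  have hp : ∀ z i, p z i = x i.succ ⬝ᵥ z := fun z i => rfl
  have hsurj : Function.Surjective p := by
    intro w
    refine ⟨∑ i : Fin t, w i • (v i.succ - v 0), ?_⟩
    rw [map_sum]
    funext i
    rw [Finset.sum_apply, Finset.sum_eq_single i]
    · have h1 := hval i.succ i.succ
      have h2 := hval 0 i.succ
      rw [if_pos rfl] at h1
      rw [if_neg (Fin.succ_ne_zero i)] at h2
      rw [map_smul, Pi.smul_apply, hp, dotProduct_sub, smul_eq_mul]
      have : x i.succ ⬝ᵥ v i.succ - x i.succ ⬝ᵥ v 0 = 1 := by linarith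
      rw [this, mul_one]
    · intro j _ hj
      have h1 := hval j.succ i.succ
      have h2 := hval 0 i.succ
      rw [if_neg (fun h => hj (Fin.succ_injective _ h).symm)] at h1
      rw [if_neg (Fin.succ_ne_zero i)] at h2
      rw [map_smul, Pi.smul_apply, hp, dotProduct_sub, smul_eq_mul]
      have : x i.succ ⬝ᵥ v j.succ - x i.succ ⬝ᵥ v 0 = 0 := by linarith
      rw [this, mul_zero]
    · simp
  obtain ⟨k, hk, φ, hφ⟩ := exists_linearEquiv_snd_eq p hsurj
  let f : (Fin n → ℝ) ≃ᵃ[ℝ] (Fin k → ℝ) × (Fin t → ℝ) :=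
    (AffineEquiv.constVAdd ℝ _ (-intVec (v 0))).trans (realExtEquiv φ).toAffineEquiv
  have hf : ∀ z, f (intVec z) = (intVec (φ (z - v 0)).1, intVec (φ (z - v 0)).2) := by
    intro z
    rw [← realExtEquiv_intVec]
    change realExtEquiv φ (-intVec (v 0) + intVec z) = _
    congr 1
    funext j
    simp [intVec]
    ring
  have hvec : ∀ z ∈ V, ∀ j, x j ⬝ᵥ z - y j ≠ 0 → intVec (φ (z - v 0)).2 = cayleyVec t j := by
    intro z hz j hj
    funext i
    have h1 := h.eq_ite_of_ne_zero hz hj i.succ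
    have h2 := hval 0 i.succ
    rw [if_neg (Fin.succ_ne_zero i)] at h2
    have h3 : (φ (z - v 0)).2 i = if i.succ = j then 1 else 0 := by
      rw [hφ, hp, dotProduct_sub, ← h1]
      linarith
    simp only [intVec, h3]
    cases j using Fin.cases with
    | zero => simp [cayleyVec_zero, Fin.succ_ne_zero]
    | succ j => simp [cayleyVec_succ, stdBasisVec]
  refine ⟨k, hk, fun j => (V.filter fun z => x j ⬝ᵥ z - y j ≠ 0).image fun z => (φ (z - v 0)).1,
    fun j => ⟨_, Finset.mem_image_of_mem _ (Finset.mem_filter.2 ⟨hvV j, hv j⟩)⟩, f, ?_, ?_⟩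
  · ext ⟨p₁, p₂⟩
    constructor
    · rintro ⟨_, ⟨z, rfl⟩, hz⟩
      have := hf z
      rw [show f (fun j => (z j : ℝ)) = f (intVec z) from rfl, this] at hz
      obtain ⟨rfl, rfl⟩ := Prod.mk.inj hz
      exact ⟨⟨_, rfl⟩, ⟨_, rfl⟩⟩
    · rintro ⟨⟨z₁, hz₁⟩, ⟨z₂, hz₂⟩⟩
      refine ⟨intVec (φ.symm (z₁, z₂) + v 0), ⟨_, rfl⟩, ?_⟩
      rw [hf, add_sub_cancel_right, LinearEquiv.apply_symm_apply]
      exact Prod.ext hz₁ hz₂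
  · have h1 := f.toAffineMap.image_convexHull (intVec '' (V : Set (Fin n → ℤ)))
    rw [AffineEquiv.coe_toAffineMap] at h1
    rw [h1, cayleySum, convexHull_iUnion_convexHull_prod_singleton]
    congr 1
    ext ⟨p₁, p₂⟩
    simp only [Set.mem_iUnion, Set.mem_prod, Set.mem_singleton_iff]
    constructor
    · rintro ⟨_, ⟨z, hz, rfl⟩, hzp⟩
      obtain ⟨j, hj⟩ := h.exists_ne_zero_of_mem hz
      rw [hf] at hzp
      obtain ⟨rfl, rfl⟩ := Prod.mk.inj hzp
      exact ⟨j, ⟨_, Finset.mem_coe.2 (Finset.mem_image_of_mem _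
        (Finset.mem_filter.2 ⟨hz, hj⟩)), rfl⟩, hvec z hz j hj⟩
    · rintro ⟨j, ⟨_, hw, hwp⟩, hp₂⟩
      obtain ⟨z, hz, rfl⟩ := Finset.mem_image.1 (Finset.mem_coe.1 hw)
      obtain ⟨hzV, hzj⟩ := Finset.mem_filter.1 hz
      refine ⟨_, ⟨z, hzV, rfl⟩, ?_⟩
      rw [hf]
      exact Prod.ext hwp ((hvec z hzV j hzj).trans hp₂.symm)

theorem IsCayley.unimodEquiv_unimodSimplex {n : ℕ} {P : Set (Fin n → ℝ)} (h : IsCayley P 0 n) :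
    UnimodEquiv P (unimodSimplex n) := by
  obtain ⟨-, Q, hQ, f, hf, hfP⟩ := h
  let g : ((Fin 0 → ℝ) × (Fin n → ℝ)) ≃ₗ[ℝ] (Fin n → ℝ) := LinearEquiv.uniqueProd
  have hg : (g.toAffineEquiv : (Fin 0 → ℝ) × (Fin n → ℝ) → (Fin n → ℝ)) = Prod.snd := rfl
  refine ⟨f.trans g.toAffineEquiv, ?_, ?_⟩
  · rw [AffineEquiv.coe_trans, Set.image_comp, hf, hg]
    exact Set.snd_image_prod (s := IntPts 0) (Set.range_nonempty _) (IntPts n)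
  · have h1 := g.toAffineEquiv.toAffineMap.image_convexHull
    rw [AffineEquiv.coe_toAffineMap] at h1
    rw [AffineEquiv.coe_trans, Set.image_comp, hfP, cayleySum, h1, Set.image_iUnion,
      unimodSimplex, hg]
    congr 1
    have h2 : ∀ j, Prod.snd '' ((convexHull ℝ ((fun z : Fin 0 → ℤ => fun i => ((z i : ℝ))) ''
        (Q j : Set (Fin 0 → ℤ)))) ×ˢ ({cayleyVec n j} : Set (Fin n → ℝ))) = {cayleyVec n j} :=
      fun j => Set.snd_image_prod (convexHull_nonempty_iff.2 ((hQ j).to_set.image _)) _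
    simp only [h2, Set.iUnion_singleton_eq_range]
    ext z
    simp [Fin.exists_fin_succ, cayleyVec_zero, cayleyVec_succ, eq_comm]

theorem IsLatticePartition.exists_fin {n : ℕ} {V : Finset (Fin n → ℤ)} (hV : V.Nonempty)
    {κ : Type*} [Fintype κ] {x : κ → Fin n → ℤ} {y : κ → ℤ} (h : IsLatticePartition V x y) :
    ∃ (t : ℕ) (x' : Fin (t + 1) → Fin n → ℤ) (y' : Fin (t + 1) → ℤ),
      IsLatticePartition V x' y' ∧ Fintype.card κ = t + 1 := by
  obtain ⟨v, hv⟩ := hV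
  obtain ⟨j, -⟩ := h.exists_ne_zero_of_mem hv
  have : Nonempty κ := ⟨j⟩
  obtain ⟨t, ht⟩ := Nat.exists_eq_succ_of_ne_zero (Fintype.card_ne_zero (α := κ))
  exact ⟨t, _, _, h.reindex (Fintype.equivFinOfCardEq ht).symm, ht⟩

theorem intCast_dotProduct_sub {n : ℕ} (a v : Fin n → ℤ) (b : ℤ) :
    ((a ⬝ᵥ v - b : ℤ) : ℝ) = intVec a ⬝ᵥ intVec v - b := by
  simp [dotProduct]

theorem sum_mul_intCast_dotProduct_sub {ι : Type*} [Fintype ι] {n : ℕ} (c : ι → ℝ)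
    (a : ι → Fin n → ℤ) (b : ι → ℤ) (v : Fin n → ℤ) :
    ∑ i, c i * ((a i ⬝ᵥ v - b i : ℤ) : ℝ) =
      (∑ i, c i • intVec (a i)) ⬝ᵥ intVec v - ∑ i, c i * (b i : ℝ) := by
  simp only [intCast_dotProduct_sub, mul_sub, Finset.sum_sub_distrib, sum_dotProduct,
    smul_dotProduct, smul_eq_mul]

theorem exists_isLatticePartition {ι : Type*} [Fintype ι] {n : ℕ} {V : Finset (Fin n → ℤ)}
    (hV : V.Nonempty) (a : ι → Fin n → ℤ) (b : ι → ℤ)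
    (hab : ∀ i, ∀ v ∈ V, 0 ≤ a i ⬝ᵥ v - b i)
    (hfull : ∀ (u : Fin n → ℝ) (w : ℝ), (∀ v ∈ V, u ⬝ᵥ intVec v - w = 0) → u = 0 ∧ w = 0)
    (c : ι → ℝ) (hc : ∀ i, 0 ≤ c i) (hca : ∑ i, c i • intVec (a i) = 0)
    (hcb : ∑ i, c i * (b i : ℝ) = -1)
    (hli : LinearIndepOn ℝ (fun i => (intVec (a i), -(b i : ℝ))) {i | c i ≠ 0}) :
    ∃ (t : ℕ) (x : Fin (t + 1) → Fin n → ℤ) (y : Fin (t + 1) → ℤ), IsLatticePartition V x y ∧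
      (2 * ∑ i, c i - n ≤ t + 1 ∨ ∑ i, c i = t + 1) := by
  classical
  have habR : ∀ i, ∀ v ∈ V, 0 ≤ ((a i ⬝ᵥ v - b i : ℤ) : ℝ) := fun i v hv => by
    exact_mod_cast hab i v hv
  have hsum : ∀ v, ∑ i, c i * ((a i ⬝ᵥ v - b i : ℤ) : ℝ) = 1 := by
    intro v
    rw [sum_mul_intCast_dotProduct_sub, hca, hcb]
    simp
  set A : Finset ι := Finset.univ.filter fun i => 1 / 2 < c i with hA
  have hmemA : ∀ i, i ∈ A ↔ 1 / 2 < c i := fun i => by simp [hA]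
  have hA1 : ∀ v ∈ V, ∑ i ∈ A, (a i ⬝ᵥ v - b i) ≤ 1 := by
    intro v hv
    by_contra! h2
    have h3 : ∑ i ∈ A, c i * ((a i ⬝ᵥ v - b i : ℤ) : ℝ) ≤ 1 := by
      rw [← hsum v]
      exact Finset.sum_le_sum_of_subset_of_nonneg (Finset.subset_univ _)
        fun i _ _ => mul_nonneg (hc i) (habR i v hv)
    obtain ⟨i, hi, hiv⟩ : ∃ i ∈ A, 0 < a i ⬝ᵥ v - b i := by
      by_contra! h0
      have := Finset.sum_nonpos h0
      omega
    have h4 : ∑ i ∈ A, 1 / 2 * ((a i ⬝ᵥ v - b i : ℤ) : ℝ) <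
        ∑ i ∈ A, c i * ((a i ⬝ᵥ v - b i : ℤ) : ℝ) := by
      refine Finset.sum_lt_sum (fun j hj =>
        mul_le_mul_of_nonneg_right ((hmemA j).1 hj).le (habR j v hv)) ⟨i, hi, ?_⟩
      exact mul_lt_mul_of_pos_right ((hmemA i).1 hi) (by exact_mod_cast hiv)
    rw [← Finset.mul_sum, ← Int.cast_sum] at h4
    have h5 : (2 : ℝ) ≤ ((∑ i ∈ A, (a i ⬝ᵥ v - b i) : ℤ) : ℝ) := by exact_mod_cast h2
    linarith
  have hne : ∀ i, c i ≠ 0 → ∃ v ∈ V, a i ⬝ᵥ v - b i ≠ 0 := by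
    intro i hi
    by_contra! h0
    obtain ⟨h1, h2⟩ := hfull (intVec (a i)) (b i) (fun v hv => by
      rw [← intCast_dotProduct_sub, h0 v hv, Int.cast_zero])
    refine hli.ne_zero (show i ∈ {i | c i ≠ 0} from hi) ?_
    simp only [h1, h2, neg_zero]
    rfl
  have hle : ∀ i, c i ≤ 1 := by
    intro i
    by_cases hi : c i = 0
    · simp [hi]
    obtain ⟨v, hv, hiv⟩ := hne i hi
    have h1 : (1 : ℝ) ≤ ((a i ⬝ᵥ v - b i : ℤ) : ℝ) := by
      have := hab i v hv
      exact_mod_cast (by omega : 1 ≤ a i ⬝ᵥ v - b i)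
    have h2 := Finset.single_le_sum (f := fun i => c i * ((a i ⬝ᵥ v - b i : ℤ) : ℝ))
      (fun j _ => mul_nonneg (hc j) (habR j v hv)) (Finset.mem_univ i)
    rw [hsum] at h2
    nlinarith [hc i]
  have hSA : ∀ i ∈ A, c i ≠ 0 := fun i hi => by
    have := (hmemA i).1 hi
    intro h0
    rw [h0] at this
    linarith
  have hScard : (Finset.univ.filter fun i => c i ≠ 0).card ≤ n + 1 := by
    have h1 := hli.linearIndependent.fintype_card_le_finrank
    rw [Fintype.card_subtype] at h1
    simpa using h1
  have hcount : 2 * ∑ i, c i ≤ A.card + (n + 1) := by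
    have h1 : ∀ i, 2 * c i ≤ (if 1 / 2 < c i then 1 else 0) + (if c i ≠ 0 then 1 else 0) := by
      intro i
      have := hle i
      by_cases h3 : c i = 0
      · rw [h3]
        norm_num
      · rw [if_pos h3]
        split_ifs with h2 <;> linarith
    have h2 := Finset.sum_le_sum fun i (_ : i ∈ Finset.univ) => h1 i
    rw [← Finset.mul_sum, Finset.sum_add_distrib, Finset.sum_boole, Finset.sum_boole] at h2
    have h3 : ((Finset.univ.filter fun i => c i ≠ 0).card : ℝ) ≤ n + 1 := by
      exact_mod_cast hScard
    linarith
  by_cases hr : ∀ v ∈ V, ∑ i ∈ A, (a i ⬝ᵥ v - b i) = 1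
  · have hpart : IsLatticePartition V (fun i : A => a i) (fun i : A => b i) :=
      ⟨fun i => hab i, fun v hv => by
        rw [← hr v hv]; exact Finset.sum_coe_sort A (fun i => a i ⬝ᵥ v - b i),
        fun i => hne i (hSA i i.2)⟩
    obtain ⟨t, x, y, hxy, ht⟩ := hpart.exists_fin hV
    refine ⟨t, x, y, hxy, Or.inr ?_⟩
    set g : ι → ℝ := fun i => c i - if i ∈ A then 1 else 0 with hg
    have hgv : ∀ v ∈ V, ∑ i, g i * ((a i ⬝ᵥ v - b i : ℤ) : ℝ) = 0 := by
      intro v hv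
      simp only [hg, sub_mul, Finset.sum_sub_distrib, hsum, ite_mul, one_mul, zero_mul,
        Finset.sum_ite_mem, Finset.univ_inter]
      rw [← Int.cast_sum, hr v hv]
      simp
    obtain ⟨h1, h2⟩ := hfull (∑ i, g i • intVec (a i)) (∑ i, g i * (b i : ℝ)) (fun v hv => by
      rw [← sum_mul_intCast_dotProduct_sub, hgv v hv])
    have hS : ((Finset.univ.filter fun i => c i ≠ 0 : Finset ι) : Set ι) = {i | c i ≠ 0} := by
      ext; simp
    have hgS : ∀ i, c i = 0 → g i = 0 := by
      intro i hi
      have : i ∉ A := fun h => hSA i h hi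
      simp [hg, this, hi]
    rw [← hS, linearIndepOn_finset_iff] at hli
    have h3 := hli g (by
      rw [Finset.sum_filter_of_ne (p := fun i => c i ≠ 0)]
      · ext1
        · simpa [Prod.fst_sum] using h1
        · simpa [Prod.snd_sum] using h2
      · intro i _ hi hci
        exact hi (by rw [hgS i hci, zero_smul]))
    have h4 : ∀ i, c i = if i ∈ A then 1 else 0 := by
      intro i
      rw [← sub_eq_zero]
      by_cases hi : c i = 0
      · exact hgS i hi
      · exact h3 i (by simpa using hi)
    rw [Fintype.card_coe] at ht
    simp only [h4, Finset.sum_boole, Finset.filter_mem_eq_inter, Finset.univ_inter, ht]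
    push_cast
    rfl
  · push Not at hr
    obtain ⟨v₀, hv₀, hne₀⟩ := hr
    let x' : Option A → Fin n → ℤ := fun o => o.elim (-∑ i ∈ A, a i) (fun i => a i)
    let y' : Option A → ℤ := fun o => o.elim (-1 - ∑ i ∈ A, b i) (fun i => b i)
    have hnone : ∀ v, x' none ⬝ᵥ v - y' none = 1 - ∑ i ∈ A, (a i ⬝ᵥ v - b i) := by
      intro v
      simp only [x', y', Option.elim_none, neg_dotProduct, sum_dotProduct,
        Finset.sum_sub_distrib]
      ring
    have hpart : IsLatticePartition V x' y' := by
      refine ⟨?_, ?_, ?_⟩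
      · rintro (_ | i) v hv
        · rw [hnone]
          have := hA1 v hv
          omega
        · exact hab i v hv
      · intro v hv
        rw [Fintype.sum_option, hnone]
        have : ∑ i : A, (x' (some i) ⬝ᵥ v - y' (some i)) = ∑ i ∈ A, (a i ⬝ᵥ v - b i) :=
          Finset.sum_coe_sort A (fun i => a i ⬝ᵥ v - b i)
        rw [this]
        ring
      · rintro (_ | i)
        · exact ⟨v₀, hv₀, by rw [hnone]; omega⟩
        · exact hne i (hSA i i.2)
    obtain ⟨t, x, y, hxy, ht⟩ := hpart.exists_fin hV
    refine ⟨t, x, y, hxy, Or.inl ?_⟩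
    rw [Fintype.card_option, Fintype.card_coe] at ht
    have : (A.card : ℝ) + 1 = t + 1 := by exact_mod_cast ht
    linarith

theorem PolyDesc.le_dist_iff {n m : ℕ} (D : PolyDesc n m) {s : ℝ} {x : Fin n → ℝ} :
    s ≤ D.dist x ↔ ∀ i, s ≤ D.dF i x := by
  simp [PolyDesc.dist, Finset.le_inf'_iff]

theorem eq_zero_of_setDim_convexHull {n : ℕ} {V : Finset (Fin n → ℤ)} (hV : V.Nonempty)
    (hdim : setDim (convexHull ℝ (intVec '' (V : Set (Fin n → ℤ)))) = n)
    (u : Fin n → ℝ) (w : ℝ) (h : ∀ v ∈ V, u ⬝ᵥ intVec v - w = 0) : u = 0 ∧ w = 0 := by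
  have htop : vectorSpan ℝ (intVec '' (V : Set (Fin n → ℤ))) = ⊤ := by
    apply Submodule.eq_top_of_finrank_eq
    rw [← direction_affineSpan, ← affineSpan_convexHull, direction_affineSpan]
    simpa [setDim] using hdim
  have hle : vectorSpan ℝ (intVec '' (V : Set (Fin n → ℤ))) ≤
      LinearMap.ker (dotProductBilin ℝ ℝ u) := by
    rw [vectorSpan_def, Submodule.span_le]
    rintro _ ⟨_, ⟨v, hv, rfl⟩, _, ⟨v', hv', rfl⟩, rfl⟩
    have h1 := h v hv
    have h2 := h v' hv'
    simp only [SetLike.mem_coe, LinearMap.mem_ker, vsub_eq_sub, map_sub]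
    change u ⬝ᵥ intVec v - u ⬝ᵥ intVec v' = 0
    linarith
  have hu : u = 0 := by
    rw [htop] at hle
    refine dotProduct_eq_zero _ fun y => ?_
    exact hle (Submodule.mem_top (x := y))
  obtain ⟨v, hv⟩ := hV
  have := h v hv
  rw [hu, zero_dotProduct] at this
  exact ⟨hu, by linarith⟩

/-- **Main theorem.** Let `P` be an `n`-dimensional lattice polytope,
not unimodularly equivalent to `Δₙ`, and set `d(P) = 2(n - ⌊μ(P)⌋)` if `μ(P) ∉ ℤ` and
`d(P) = 2(n - μ(P)) + 1` if `μ(P) ∈ ℤ`. If `n > d(P)`, then `P` is a Cayley sum of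
lattice polytopes in `ℝᵐ` with `m ≤ d(P)` (hence of length `n - m + 1`). -/
theorem statement15 {n m : ℕ} (D : PolyDesc n m) (hlat : IsLatticePoly D.pts)
    (hnotsimplex : ¬ UnimodEquiv D.pts (unimodSimplex n))
    (d : ℝ)
    (hd1 : (∃ kk : ℤ, D.qcd = (kk : ℝ)) → d = 2 * ((n : ℝ) - D.qcd) + 1)
    (hd2 : (¬ ∃ kk : ℤ, D.qcd = (kk : ℝ)) → d = 2 * ((n : ℝ) - (⌊D.qcd⌋ : ℝ)))
    (hn : d < (n : ℝ)) :
    ∃ k t : ℕ, (k : ℝ) ≤ d ∧ IsCayley D.pts k t := by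
  have hs0 : D.qcdInv ≠ 0 := by
    intro h0
    have hq : D.qcd = 0 := by rw [PolyDesc.qcd, h0, inv_zero]
    have := hd1 ⟨0, by simp [hq]⟩
    rw [hq] at this
    have hn0 : (0 : ℝ) ≤ n := Nat.cast_nonneg n
    linarith
  have hbdd : BddAbove D.qcdInvSet := by
    by_contra h
    exact hs0 (Real.sSup_of_not_bddAbove h)
  have hsetne : D.qcdInvSet.Nonempty := by
    by_contra h
    rw [Set.not_nonempty_iff_eq_empty] at h
    exact hs0 (by rw [PolyDesc.qcdInv, h, Real.sSup_empty])
  have hspos : 0 < D.qcdInv :=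
    lt_of_le_of_ne (Real.sSup_nonneg fun r hr => hr.1.le) hs0.symm
  have hptsne : D.pts.Nonempty := by
    obtain ⟨r, hr0, z, hz⟩ := hsetne
    refine ⟨z, fun i => ?_⟩
    have := D.le_dist_iff.1 hz i
    rw [PolyDesc.dF] at this
    linarith
  obtain ⟨V, hPV⟩ := hlat
  change D.pts = convexHull ℝ (intVec '' (V : Set (Fin n → ℤ))) at hPV
  have hV : V.Nonempty := by
    rw [hPV, convexHull_nonempty_iff, Set.image_nonempty] at hptsne
    exact hptsne
  have hfull := eq_zero_of_setDim_convexHull hV (by rw [← hPV]; exact D.fulldim)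
  set b : Fin m → ℤ := fun i => ⌈D.b i⌉ with hb
  have hab : ∀ i, ∀ v ∈ V, 0 ≤ D.A i ⬝ᵥ v - b i := by
    intro i v hv
    have h1 : intVec v ∈ D.pts := by
      rw [hPV]
      exact subset_convexHull ℝ _ ⟨v, hv, rfl⟩
    have h2 : (D.b i : ℝ) ≤ ipair (D.A i) (intVec v) := h1 i
    have h3 : ipair (D.A i) (intVec v) = ((D.A i ⬝ᵥ v : ℤ) : ℝ) := by
      simp [ipair, dotProduct]
    rw [h3] at h2
    have h4 : D.b i ≤ ((D.A i ⬝ᵥ v : ℤ) : ℚ) := by exact_mod_cast h2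
    have h5 : b i ≤ D.A i ⬝ᵥ v := Int.ceil_le.2 h4
    omega
  have hpos : ∀ g : Fin m → ℝ, (∀ i, 0 ≤ g i) →
      (∀ v ∈ V, ∑ i, g i * ((D.A i ⬝ᵥ v - b i : ℤ) : ℝ) ≤ 0) → g = 0 := by
    intro g hg hgv
    funext i
    by_contra hi
    have hnn : ∀ v ∈ V, ∀ j, 0 ≤ g j * ((D.A j ⬝ᵥ v - b j : ℤ) : ℝ) := fun v hv j =>
      mul_nonneg (hg j) (by exact_mod_cast hab j v hv)
    have h1 := hfull (intVec (D.A i)) (b i) (fun v hv => by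
      rw [← intCast_dotProduct_sub]
      have h2 := (Finset.sum_eq_zero_iff_of_nonneg fun j _ => hnn v hv j).1
        (le_antisymm (hgv v hv) (Finset.sum_nonneg fun j _ => hnn v hv j)) i (Finset.mem_univ i)
      exact (mul_eq_zero.1 h2).resolve_left hi)
    refine (D.prim i).1 (funext fun j => ?_)
    have := congrFun h1.1 j
    simpa [intVec] using this
  have : Nonempty (Fin m) := Fin.pos_iff_nonempty.1 D.hm
  obtain ⟨w, hw0, hw1, hwa, hwb⟩ := exists_dual_weights (fun i => intVec (D.A i))
    (fun i => (b i : ℝ)) D.qcdInv (by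
      rintro r ⟨z, hz⟩
      rcases le_or_gt r 0 with hr | hr
      · linarith
      refine le_csSup hbdd ⟨hr, z, D.le_dist_iff.2 fun i => (hz i).trans ?_⟩
      have : (D.b i : ℝ) ≤ (b i : ℝ) := by exact_mod_cast Int.le_ceil (D.b i)
      change _ ≤ intVec (D.A i) ⬝ᵥ z - (D.b i : ℝ)
      linarith)
  set σ : ℝ := -∑ i, w i * (b i : ℝ) with hσ
  have hσ0 : 0 < σ := by
    by_contra! h
    have hw := hpos w hw0 (fun v _ => by
      rw [sum_mul_intCast_dotProduct_sub, hwa, zero_dotProduct]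
      linarith)
    simp [hw] at hw1
  obtain ⟨c, hc0, hcq, hcsum, hli⟩ := exists_linearIndepOn_support
    (fun i => (intVec (D.A i), -(b i : ℝ))) (by
      intro g hg hgq
      refine hpos g hg fun v _ => le_of_eq ?_
      have h1 := congrArg Prod.fst hgq
      have h2 := congrArg Prod.snd hgq
      simp only [Prod.fst_sum, Prod.snd_sum, Prod.smul_mk, smul_eq_mul, mul_neg,
        Finset.sum_neg_distrib, Prod.fst_zero, Prod.snd_zero, neg_eq_zero] at h1 h2
      rw [sum_mul_intCast_dotProduct_sub, h1, h2]
      simp)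
    (fun i => σ⁻¹ * w i) (fun i => mul_nonneg (inv_nonneg.2 hσ0.le) (hw0 i))
  have hca : ∑ i, c i • intVec (D.A i) = 0 := by
    have h1 := congrArg Prod.fst hcq
    simp only [Prod.fst_sum, Prod.smul_mk, mul_smul, ← Finset.smul_sum, hwa, smul_zero] at h1
    exact h1
  have hcb : ∑ i, c i * (b i : ℝ) = -1 := by
    have h1 := congrArg Prod.snd hcq
    simp only [Prod.snd_sum, Prod.smul_mk, smul_eq_mul, mul_neg, Finset.sum_neg_distrib,
      neg_inj, mul_assoc, ← Finset.mul_sum] at h1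
    rw [h1, show ∑ i, w i * (b i : ℝ) = -σ by rw [hσ, neg_neg], mul_neg,
      inv_mul_cancel₀ hσ0.ne']
  have hqc : D.qcd ≤ ∑ i, c i := by
    refine le_trans ?_ hcsum
    rw [← Finset.mul_sum, hw1, mul_one]
    exact inv_anti₀ hσ0 hwb
  obtain ⟨t, x, y, hxy, hL⟩ := exists_isLatticePartition hV D.A b hab hfull c hc0 hca hcb hli
  obtain ⟨k, hk⟩ := hxy.exists_isCayley
  rw [← hPV] at hk
  have hkt : (k : ℝ) + t = n := by exact_mod_cast hk.1
  have hk0 : k ≠ 0 := by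
    rintro rfl
    obtain rfl : t = n := by have := hk.1; omega
    exact hnotsimplex hk.unimodEquiv_unimodSimplex
  have hk1 : (1 : ℝ) ≤ k := by exact_mod_cast Nat.one_le_iff_ne_zero.2 hk0
  have hmain : 2 * D.qcd - n ≤ t + 1 := by
    rcases hL with h | h <;> linarith
  refine ⟨k, t, ?_, hk⟩
  by_cases hint : ∃ kk : ℤ, D.qcd = (kk : ℝ)
  · rw [hd1 hint]
    linarith
  · rw [hd2 hint]
    have hlt : (⌊D.qcd⌋ : ℝ) < D.qcd :=
      lt_of_le_of_ne (Int.floor_le _) fun h => hint ⟨_, h.symm⟩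
    have h1 : 2 * (⌊D.qcd⌋ : ℝ) - n < t + 1 := by linarith
    have h2 : 2 * ⌊D.qcd⌋ - (n : ℤ) < t + 1 := by exact_mod_cast h1
    have h3 : 2 * ⌊D.qcd⌋ - (n : ℤ) ≤ t := by omega
    have h4 : 2 * (⌊D.qcd⌋ : ℝ) - n ≤ t := by exact_mod_cast h3
    linarith

end
end
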